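/- Let T be a computable real with 0 < T < 1. Then the partition function Z(T) = Σ_{p ∈ dom U} 2^{-|p|/T} (viewed as the infinite binary sequence of its base-two expansion) is finite-state strongly predictable. -/

import Mathlib

/-- The first `n` bits of the infinite binary sequence `X` (as a finite binary string). -/
def pre (X : ℕ → Bool) (n : ℕ) : List Bool := (List.range n).map X

/-- A martingale: nonnegative betting strategy with the fairness condition. -/
def IsMartingale (B : List Bool → ℝ) : Prop :=
  (∀ x, 0 ≤ B x) ∧ ∀ x, B (x ++ [false]) + B (x ++ [true]) = 2 * B x

/-- `B` succeeds on `X`: the capital along `X` is unbounded. -/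
def Succeeds (B : List Bool → ℝ) (X : ℕ → Bool) : Prop := ∀ C : ℝ, ∃ n, C < B (pre X n)

/-- A computable martingale: `{(x,q) | q < B x}` is decidable. -/
def ComputableMartingale (B : List Bool → ℝ) : Prop :=
  IsMartingale B ∧ ∃ g : List Bool × ℚ → Bool, Computable g ∧
    ∀ p : List Bool × ℚ, g p = true ↔ (p.2 : ℝ) < B p.1

def ComputablyRandom (X : ℕ → Bool) : Prop :=
  ∀ B : List Bool → ℝ, ComputableMartingale B → ¬ Succeeds B X

def TotalStronglyPredictable (X : ℕ → Bool) : Prop :=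
  ∃ F : List Bool → Option Bool, Computable F ∧
    (∀ n b, F (pre X n) = some b → b = X n) ∧
    {n : ℕ | F (pre X n) ≠ none}.Infinite

def StronglyPredictable (X : ℕ → Bool) : Prop :=
  ∃ F : List Bool →. Option Bool, Partrec F ∧
    (∀ n, (F (pre X n)).Dom) ∧
    (∀ n b, some b ∈ F (pre X n) → b = X n) ∧
    {n : ℕ | ∃ b, some b ∈ F (pre X n)}.Infinite

def PartialComputableMartingale (B : List Bool →. ℚ) : Prop :=
  Partrec B ∧
  (∀ x q, q ∈ B x → 0 ≤ q) ∧
  (∀ x y : List Bool, x <+: y → (B y).Dom → (B x).Dom) ∧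
  (∀ x : List Bool, (B x).Dom → ((B (x ++ [false])).Dom ↔ (B (x ++ [true])).Dom)) ∧
  (∀ (x : List Bool) (q q₀ q₁ : ℚ), q ∈ B x → q₀ ∈ B (x ++ [false]) → q₁ ∈ B (x ++ [true]) →
    q₀ + q₁ = 2 * q)

def PSucceeds (B : List Bool →. ℚ) (X : ℕ → Bool) : Prop :=
  (∀ n, (B (pre X n)).Dom) ∧ ∀ C : ℚ, ∃ n, ∃ q ∈ B (pre X n), C < q

def PartialComputablyRandom (X : ℕ → Bool) : Prop :=
  ∀ B : List Bool →. ℚ, PartialComputableMartingale B → ¬ PSucceeds B X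

def FiniteStateStronglyPredictable (X : ℕ → Bool) : Prop :=
  ∃ (Q : Type) (_ : Fintype Q) (δ : Q → Bool → Q) (q₀ : Q) (f : Q → Option Bool),
    (∀ n b, f ((pre X n).foldl δ q₀) = some b → b = X n) ∧
    {n : ℕ | f ((pre X n).foldl δ q₀) ≠ none}.Infinite

/-- A prefix-free machine: a partial computable function with prefix-free domain. -/
def IsPrefixFreeMachine (M : List Bool →. List Bool) : Prop :=
  Partrec M ∧ ∀ p q : List Bool, (M p).Dom → (M q).Dom → p <+: q → p = q

/-- An optimal prefix-free machine. -/
def IsOptimalMachine (U : List Bool →. List Bool) : Prop :=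
  IsPrefixFreeMachine U ∧ ∀ M : List Bool →. List Bool, IsPrefixFreeMachine M →
    ∃ d : ℕ, ∀ p : List Bool, (M p).Dom →
      ∃ q : List Bool, q.length ≤ p.length + d ∧ U q = M p

/-- Program-size (Kolmogorov) complexity of `x` with respect to `U`. -/
noncomputable def KC (U : List Bool →. List Bool) (x : List Bool) : ℕ :=
  sInf {n : ℕ | ∃ p : List Bool, p.length = n ∧ x ∈ U p}

/-- The partition function `Z(T)` of `U` at temperature `T`. -/
noncomputable def ZT (U : List Bool →. List Bool) (T : ℝ) : ℝ :=
  ∑' p : {p : List Bool // (U p).Dom}, (2 : ℝ) ^ (-((p.1.length : ℝ)) / T)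

/-- Chaitin's Ω number of `U`. -/
noncomputable def Omega (U : List Bool →. List Bool) : ℝ :=
  ∑' p : {p : List Bool // (U p).Dom}, (2 : ℝ) ^ (-((p.1.length : ℝ)))

/-- The `n`-th bit (0-indexed) of the base-two expansion (with infinitely many zeros)
of the fractional part of `α`. -/
noncomputable def binDigit (α : ℝ) (n : ℕ) : Bool :=
  decide (⌊α * 2 ^ (n + 1)⌋ % 2 = 1)

def ComputableReal (T : ℝ) : Prop :=
  ∃ f : ℕ → ℚ, Computable f ∧ ∀ n : ℕ, |T - (f n : ℝ)| < (2 : ℝ) ^ (-(n : ℤ))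

def WeaklyChaitinRandom (U : List Bool →. List Bool) (X : ℕ → Bool) : Prop :=
  ∃ c : ℕ, ∀ n : ℕ, 1 ≤ n → (n : ℤ) - c ≤ (KC U (pre X n) : ℤ)

def WeaklyChaitinTRandom (U : List Bool →. List Bool) (T : ℝ) (X : ℕ → Bool) : Prop :=
  ∃ c : ℕ, ∀ n : ℕ, 1 ≤ n → T * n - c ≤ (KC U (pre X n) : ℝ)

def StrictlyTCompressible (U : List Bool →. List Bool) (T : ℝ) (X : ℕ → Bool) : Prop :=
  ∃ d : ℕ, ∀ n : ℕ, 1 ≤ n → (KC U (pre X n) : ℝ) ≤ T * n + d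

def StrictlyChaitinTRandom (U : List Bool →. List Bool) (T : ℝ) (X : ℕ → Bool) : Prop :=
  WeaklyChaitinTRandom U T X ∧ StrictlyTCompressible U T X

section Helpers
open Encodable

theorem comp_pow {α : Type*} [Primcodable α] {f g : α → ℕ} (hf : Computable f)
    (hg : Computable g) : Computable fun a => f a ^ g a := by
  have h : Computable fun a => Nat.rec (motive := fun _ => ℕ) 1 (fun _ IH => IH * f a) (g a) :=
    Computable.nat_rec (h := fun a p => p.2 * f a) hg (Computable.const 1)
      (Primrec.nat_mul.to_comp.comp (Computable.snd.comp Computable.snd)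
        (hf.comp Computable.fst)).to₂
  refine h.of_eq fun a => ?_
  induction g a with
  | zero => simp
  | succ n ih => simp only [pow_succ]; rw [← ih]

theorem comp_sum {α : Type*} [Primcodable α] {f : α → ℕ → ℕ} {g : α → ℕ} (hf : Computable₂ f)
    (hg : Computable g) : Computable fun a => ∑ i ∈ Finset.range (g a), f a i := by
  have h : Computable fun a => Nat.rec (motive := fun _ => ℕ) 0 (fun y IH => IH + f a y) (g a) :=
    Computable.nat_rec (h := fun a p => p.2 + f a p.1) hg (Computable.const 0)
      (Primrec.nat_add.to_comp.comp (Computable.snd.comp Computable.snd)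
        (hf.comp Computable.fst (Computable.fst.comp Computable.snd))).to₂
  refine h.of_eq fun a => ?_
  induction g a with
  | zero => simp
  | succ n ih => simp only [Finset.sum_range_succ]; rw [← ih]

theorem comp_search {α : Type*} [Primcodable α] (P : α → ℕ → Bool) (hP : Computable₂ P)
    (hex : ∀ x, ∃ k, P x k = true) : ∃ h : α → ℕ, Computable h ∧ ∀ x, P x (h x) = true := by
  refine ⟨fun x => Nat.find (hex x), ?_, fun x => Nat.find_spec (hex x)⟩
  have h : Partrec fun a => Nat.rfind (fun n => (Part.some (P a n) : Part Bool)) :=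
    Partrec.rfind (p := fun a n => (Part.some (P a n))) hP
  refine Partrec.of_eq h fun a => ?_
  change _ = Part.some _
  refine Part.eq_some_iff.2 (Nat.mem_rfind.2 ⟨?_, ?_⟩)
  · simpa using Nat.find_spec (hex a)
  · intro m hm
    have := Nat.find_min (hex a) hm
    simpa using this

section ops
variable {α : Type*} [Primcodable α] {f g : α → ℕ}
theorem comp_add (hf : Computable f) (hg : Computable g) : Computable fun a => f a + g a :=
  Primrec.nat_add.to_comp.comp hf hg
theorem comp_mul (hf : Computable f) (hg : Computable g) : Computable fun a => f a * g a :=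
  Primrec.nat_mul.to_comp.comp hf hg
theorem comp_sub (hf : Computable f) (hg : Computable g) : Computable fun a => f a - g a :=
  Primrec.nat_sub.to_comp.comp hf hg
theorem comp_div (hf : Computable f) (hg : Computable g) : Computable fun a => f a / g a :=
  Primrec.nat_div.to_comp.comp hf hg
theorem comp_mod (hf : Computable f) (hg : Computable g) : Computable fun a => f a % g a :=
  Primrec.nat_mod.to_comp.comp hf hg
theorem comp_le (hf : Computable f) (hg : Computable g) :
    Computable fun a => decide (f a ≤ g a) :=
  (Primrec.nat_le.decide).to_comp.comp hf hg
theorem comp_eq (hf : Computable f) (hg : Computable g) :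
    Computable fun a => decide (f a = g a) :=
  (Primrec.eq.decide).to_comp.comp hf hg
theorem comp_and {p q : α → Bool} (hf : Computable p) (hg : Computable q) :
    Computable fun a => p a && q a :=
  Primrec.and.to_comp.comp hf hg
theorem comp_ind {p : α → Bool} (hf : Computable p) :
    Computable fun a => bif p a then 1 else 0 :=
  Computable.cond hf (Computable.const 1) (Computable.const 0)
theorem comp_toNat {p : α → Bool} (hf : Computable p) :
    Computable fun a => (p a).toNat :=
  (comp_ind hf).of_eq fun a => by cases p a <;> rfl
end ops

/-- raw code of a rational -/
def rawc (q : ℚ) : ℕ := @Encodable.encode ℚ Rat.instEncodable q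

theorem rawc_eq (q : ℚ) : rawc q = Nat.pair (encode q.num) q.den := by
  rfl

theorem encq (q : ℚ) : @encode ℚ (Primcodable.toEncodable) q
    = ((List.range (rawc q)).countP
      (fun y => @decide (y ∈ Set.range (@encode ℚ Rat.instEncodable))
        (@decidableRangeEncode ℚ Rat.instEncodable y))) := by
  rfl

theorem enc_int_ofNat (n : ℕ) : encode (Int.ofNat n) = 2 * n := rfl
theorem enc_int_negSucc (n : ℕ) : encode (Int.negSucc n) = 2 * n + 1 := rfl

theorem enc_int_natAbs (z : ℤ) : z.natAbs = (encode z + 1) / 2 := by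
  rcases z with n | n
  · rw [enc_int_ofNat]; simp; omega
  · rw [enc_int_negSucc]; simp; omega

theorem enc_int_toNat (z : ℤ) : z.toNat = (1 - encode z % 2) * (encode z / 2) := by
  rcases z with n | n
  · rw [enc_int_ofNat]; simp
  · rw [enc_int_negSucc]
    have : (2 * n + 1) % 2 = 1 := by omega
    simp [this]

/-- number of nontrivial common divisors -/
def cdiv (a d : ℕ) : ℕ :=
  ∑ k ∈ Finset.range (d + 1), (decide (2 ≤ k) && (decide (a % k = 0) && decide (d % k = 0))).toNat

theorem cdiv_eq_zero (a d : ℕ) (hd : 0 < d) : cdiv a d = 0 ↔ a.Coprime d := by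
  unfold cdiv
  rw [Finset.sum_eq_zero_iff]
  constructor
  · intro h
    by_contra hc
    have hg : a.gcd d ≤ d := Nat.gcd_le_right _ hd
    have hg0 : 0 < a.gcd d := Nat.gcd_pos_of_pos_right _ hd
    have hg1 : a.gcd d ≠ 1 := hc
    have := h (a.gcd d) (by simp; omega)
    rw [Nat.mod_eq_zero_of_dvd (Nat.gcd_dvd_left a d),
      Nat.mod_eq_zero_of_dvd (Nat.gcd_dvd_right a d)] at this
    have h2 : 2 ≤ a.gcd d := by omega
    simp [h2] at this
  · intro h k hk
    by_contra hne
    have : 2 ≤ k ∧ a % k = 0 ∧ d % k = 0 := by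
      by_contra hh
      apply hne
      simp only [← Bool.decide_and]
      simp [hh]
    obtain ⟨h2, ha, hd⟩ := this
    have := Nat.dvd_gcd (Nat.dvd_of_mod_eq_zero ha) (Nat.dvd_of_mod_eq_zero hd)
    rw [h] at this
    have := Nat.le_of_dvd one_pos this
    omega

/-- Boolean test for being a raw code -/
def isR (y : ℕ) : Bool :=
  decide (1 ≤ y.unpair.2) && decide (cdiv ((y.unpair.1 + 1) / 2) y.unpair.2 = 0)

theorem isR_iff (y : ℕ) : isR y = true ↔ y ∈ Set.range rawc := by
  unfold isR
  simp only [Bool.and_eq_true, decide_eq_true_eq]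
  constructor
  · rintro ⟨h1, h2⟩
    rw [cdiv_eq_zero _ _ h1] at h2
    obtain ⟨z, hz⟩ : ∃ z : ℤ, encode z = y.unpair.1 := ⟨Denumerable.ofNat ℤ y.unpair.1, by
      exact Denumerable.encode_ofNat (α := ℤ) _⟩
    refine ⟨⟨z, y.unpair.2, by omega, ?_⟩, ?_⟩
    · rw [enc_int_natAbs, hz]; exact h2
    · rw [rawc_eq]; simp only [hz]; simp
  · rintro ⟨q, rfl⟩
    rw [rawc_eq]
    simp only [Nat.unpair_pair]
    refine ⟨q.pos, ?_⟩
    rw [cdiv_eq_zero _ _ q.pos, ← enc_int_natAbs]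
    exact q.reduced

theorem encq' (q : ℚ) : @encode ℚ (Primcodable.toEncodable) q
    = ∑ y ∈ Finset.range (rawc q), (isR y).toNat := by
  rw [encq]
  have key : ∀ n : ℕ, (List.range n).countP
      (fun y => @decide (y ∈ Set.range (@encode ℚ Rat.instEncodable))
        (@decidableRangeEncode ℚ Rat.instEncodable y)) = ∑ y ∈ Finset.range n, (isR y).toNat := by
    intro n
    induction n with
    | zero => simp
    | succ n ih =>
      rw [List.range_succ, List.countP_append, ih, Finset.sum_range_succ]
      congr 1
      have := isR_iff n
      by_cases h : isR n = true
      · have h2 : n ∈ Set.range (@encode ℚ Rat.instEncodable) := this.1 h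
        simp only [List.countP_singleton, h]
        rw [if_pos (by simpa using h2)]; rfl
      · have h2 : ¬ n ∈ Set.range (@encode ℚ Rat.instEncodable) := fun h' => h (this.2 h')
        simp only [List.countP_singleton, h]
        rw [if_neg (by simpa using h2)]; rfl
  exact key _

theorem comp_cdiv {α : Type*} [Primcodable α] {f g : α → ℕ} (hf : Computable f)
    (hg : Computable g) : Computable fun a => cdiv (f a) (g a) := by
  unfold cdiv
  refine comp_sum (f := fun a k => (decide (2 ≤ k) && (decide (f a % k = 0) &&
    decide (g a % k = 0))).toNat) ?_ (comp_add hg (Computable.const 1))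
  refine (comp_toNat (comp_and (comp_le (Computable.const 2) Computable.snd) (comp_and
    (comp_eq (comp_mod (hf.comp Computable.fst) Computable.snd) (Computable.const 0))
    (comp_eq (comp_mod (hg.comp Computable.fst) Computable.snd) (Computable.const 0))))).to₂

theorem comp_isR : Computable isR := by
  have h1 : Computable fun y : ℕ => y.unpair.1 := Computable.fst.comp Primrec.unpair.to_comp
  have h2 : Computable fun y : ℕ => y.unpair.2 := Computable.snd.comp Primrec.unpair.to_comp
  exact comp_and (comp_le (Computable.const 1) h2) (comp_eq (comp_cdiv
    (comp_div (comp_add h1 (Computable.const 1)) (Computable.const 2)) h2) (Computable.const 0))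

theorem exists_nat_approx (T : ℝ) (hT0 : 0 < T) (hTc : ComputableReal T) :
    ∃ g : ℕ → ℕ, Computable g ∧ ∀ u, |T * 2 ^ u - g u| ≤ 2 := by
  obtain ⟨f, hf, hT⟩ := hTc
  have hfe : Computable fun u => @encode ℚ (Primcodable.toEncodable) (f u) :=
    Computable.encode.comp hf
  obtain ⟨h, hh, hspec⟩ := comp_search (fun u y => isR y && decide
    (∑ k ∈ Finset.range y, (isR k).toNat = @encode ℚ (Primcodable.toEncodable) (f u)))
    (comp_and (comp_isR.comp Computable.snd) (comp_eq
      (comp_sum (f := fun _ k => (isR k).toNat)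
        (comp_toNat (comp_isR.comp Computable.snd)).to₂ Computable.snd)
      (hfe.comp Computable.fst))).to₂
    (fun u => ⟨rawc (f u), by
      simp only [Bool.and_eq_true, decide_eq_true_eq]
      exact ⟨(isR_iff _).2 ⟨_, rfl⟩, (encq' _).symm⟩⟩)
  have hh' : ∀ u, h u = rawc (f u) := by
    intro u
    have := hspec u
    simp only [Bool.and_eq_true, decide_eq_true_eq] at this
    obtain ⟨q, hq⟩ := (isR_iff _).1 this.1
    have h2 := this.2
    rw [← hq, ← encq'] at h2
    rw [← hq, @Encodable.encode_injective ℚ Primcodable.toEncodable _ _ h2]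
  have h1 : Computable fun u => (h u).unpair.1 :=
    Computable.fst.comp (Primrec.unpair.to_comp.comp hh)
  have h2 : Computable fun u => (h u).unpair.2 :=
    Computable.snd.comp (Primrec.unpair.to_comp.comp hh)
  refine ⟨fun u => ((1 - (h u).unpair.1 % 2) * ((h u).unpair.1 / 2)) * 2 ^ u / (h u).unpair.2,
    comp_div (comp_mul (comp_mul (comp_sub (Computable.const 1)
      (comp_mod h1 (Computable.const 2))) (comp_div h1 (Computable.const 2)))
      (comp_pow (Computable.const 2) Computable.id)) h2, fun u => ?_⟩
  have e : ((1 - (h u).unpair.1 % 2) * ((h u).unpair.1 / 2)) * 2 ^ u / (h u).unpair.2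
      = (f u).num.toNat * 2 ^ u / (f u).den := by
    rw [hh', rawc_eq, enc_int_toNat]; simp only [Nat.unpair_pair]
  simp only [e]
  have hTu : |T * 2 ^ u - f u * 2 ^ u| < 1 := by
    rw [← sub_mul, abs_mul, abs_of_pos (by positivity : (0:ℝ) < 2 ^ u)]
    have := hT u
    rw [zpow_neg, zpow_natCast] at this
    calc _ < ((2:ℝ) ^ u)⁻¹ * 2 ^ u := by gcongr
      _ = 1 := by field_simp
  have hfl : (((f u).num.toNat * 2 ^ u / (f u).den : ℕ) : ℝ)
      = ⌊(((f u).num.toNat * 2 ^ u : ℕ) : ℝ) / ((f u).den : ℝ)⌋₊ := by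
    rw [Nat.floor_div_eq_div]
  rw [hfl]
  have hden : (0:ℝ) < (f u).den := by exact_mod_cast (f u).pos
  rcases le_or_gt 0 (f u).num with h0 | h0
  · have : (((f u).num.toNat * 2 ^ u : ℕ) : ℝ) / ((f u).den : ℝ) = f u * 2 ^ u := by
      rw [Rat.cast_def (f u)]
      have : (((f u).num.toNat : ℕ) : ℝ) = ((f u).num : ℝ) := by
        have := Int.toNat_of_nonneg h0
        exact_mod_cast this
      push_cast
      rw [this]; ring
    rw [this]
    have hp : (0:ℝ) ≤ f u * 2 ^ u := by
      have : (0:ℝ) ≤ f u := by exact_mod_cast Rat.num_nonneg.1 h0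
      positivity
    have a1 := Nat.floor_le hp
    have a2 := Nat.lt_floor_add_one ((f u : ℝ) * 2 ^ u)
    rw [abs_lt] at hTu
    rw [abs_le]; constructor <;> linarith [hTu.1, hTu.2]
  · have : (f u).num.toNat = 0 := Int.toNat_eq_zero.2 h0.le
    rw [this]; simp
    have hq : (f u : ℝ) < 0 := by exact_mod_cast Rat.num_neg.1 h0
    have : (f u : ℝ) * 2 ^ u < 0 := mul_neg_of_neg_of_pos hq (by positivity)
    rw [abs_of_pos hT0]
    rw [abs_lt] at hTu
    linarith [hTu.2]

open Encodable

theorem rpow_root (x : ℝ) (hx : 0 ≤ x) (a u : ℕ) :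
    (x ^ ((a : ℝ) / 2 ^ u)) ^ (2 ^ u) = x ^ a := by
  rw [← Real.rpow_natCast, ← Real.rpow_mul hx, ← Real.rpow_natCast x a]
  congr 1; push_cast; field_simp

theorem root_le_iff (x : ℝ) (hx : 0 ≤ x) (a u l : ℕ) :
    x ^ ((a : ℝ) / 2 ^ u) ≤ ((2:ℝ) ^ l)⁻¹ ↔ x ^ a * 2 ^ (l * 2 ^ u) ≤ 1 := by
  rw [← pow_le_pow_iff_left₀ (by positivity) (by positivity) (pow_ne_zero u two_ne_zero : 2 ^ u ≠ 0),
    rpow_root x hx, inv_pow, ← pow_mul, ← one_div, le_div_iff₀ (by positivity)]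

theorem le_root_iff (x : ℝ) (hx : 0 ≤ x) (a u l : ℕ) :
    ((2:ℝ) ^ l)⁻¹ ≤ x ^ ((a : ℝ) / 2 ^ u) ↔ 1 ≤ x ^ a * 2 ^ (l * 2 ^ u) := by
  rw [← pow_le_pow_iff_left₀ (by positivity) (by positivity) (pow_ne_zero u two_ne_zero : 2 ^ u ≠ 0),
    rpow_root x hx, inv_pow, ← pow_mul, ← one_div, div_le_iff₀ (by positivity)]

theorem two_root (T : ℝ) (hT0 : 0 < T) (l : ℕ) :
    ((2:ℝ) ^ (-(l:ℝ) / T)) ^ T = ((2:ℝ) ^ l)⁻¹ := by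
  rw [← Real.rpow_mul (by norm_num), div_mul_cancel₀ _ hT0.ne', Real.rpow_neg (by norm_num),
    Real.rpow_natCast]

theorem cast_le_iff1 (k a s l u : ℕ) :
    k ^ a * 2 ^ (l * 2 ^ u) ≤ 2 ^ (s * a) ↔
      ((k:ℝ) / 2 ^ s) ^ a * 2 ^ (l * 2 ^ u) ≤ 1 := by
  rw [div_pow, ← pow_mul, div_mul_eq_mul_div, div_le_one (by positivity)]
  exact_mod_cast Iff.rfl

theorem cast_le_iff2 (k a s l u : ℕ) :
    2 ^ (s * a) ≤ k ^ a * 2 ^ (l * 2 ^ u) ↔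
      1 ≤ ((k:ℝ) / 2 ^ s) ^ a * 2 ^ (l * 2 ^ u) := by
  rw [div_pow, ← pow_mul, div_mul_eq_mul_div, one_le_div (by positivity)]
  exact_mod_cast Iff.rfl

theorem tendsto_approx (T : ℝ) (a : ℕ → ℕ) (h : ∀ u, |T * 2 ^ u - a u| ≤ 4) :
    Filter.Tendsto (fun u => (a u : ℝ) / 2 ^ u) Filter.atTop (nhds T) := by
  have h4 : Filter.Tendsto (fun u : ℕ => 4 * ((1:ℝ) / 2) ^ u) Filter.atTop (nhds 0) := by
    simpa using (tendsto_pow_atTop_nhds_zero_of_lt_one (r := (1:ℝ)/2) (by norm_num)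
      (by norm_num)).const_mul 4
  rw [tendsto_iff_dist_tendsto_zero]
  refine squeeze_zero (fun _ => dist_nonneg) (fun u => ?_) h4
  rw [Real.dist_eq, abs_sub_comm]
  have : T - (a u : ℝ) / 2 ^ u = (T * 2 ^ u - a u) * (1 / 2) ^ u := by
    rw [one_div, inv_pow]; field_simp
  rw [this, abs_mul, abs_of_pos (by positivity : (0:ℝ) < (1 / 2) ^ u)]
  gcongr
  exact h u

theorem exists_v (T : ℝ) (hT0 : 0 < T) (g : ℕ → ℕ) (hg : Computable g)
    (hgT : ∀ u, |T * 2 ^ u - g u| ≤ 2) :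
    ∃ v : ℕ → ℕ → ℕ, Computable₂ v ∧ ∀ s l : ℕ,
      (v s l : ℝ) ≤ 2 ^ s * (2:ℝ) ^ (-(l:ℝ) / T) ∧ 2 ^ s * (2:ℝ) ^ (-(l:ℝ) / T) ≤ v s l + 2 := by
  have c1 : Computable fun z : (ℕ × ℕ) × ℕ => z.1.1 := Computable.fst.comp Computable.fst
  have c2 : Computable fun z : (ℕ × ℕ) × ℕ => z.1.2 := Computable.snd.comp Computable.fst
  have ck : Computable fun z : (ℕ × ℕ) × ℕ => z.2.unpair.1 :=
    Computable.fst.comp (Primrec.unpair.to_comp.comp Computable.snd)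
  have cu : Computable fun z : (ℕ × ℕ) × ℕ => z.2.unpair.2 :=
    Computable.snd.comp (Primrec.unpair.to_comp.comp Computable.snd)
  have cg : Computable fun z : (ℕ × ℕ) × ℕ => g z.2.unpair.2 := hg.comp cu
  have two : Computable fun _ : (ℕ × ℕ) × ℕ => 2 := Computable.const 2
  obtain ⟨h, hh, hspec⟩ := comp_search (α := ℕ × ℕ) (fun sl y =>
    decide (y.unpair.1 ≤ 2 ^ sl.1) && (
    decide (y.unpair.1 ^ (g y.unpair.2 - 2) * 2 ^ (sl.2 * 2 ^ y.unpair.2) ≤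
      2 ^ (sl.1 * (g y.unpair.2 - 2))) &&
    decide (2 ^ (sl.1 * (g y.unpair.2 + 2)) ≤
      (y.unpair.1 + 2) ^ (g y.unpair.2 + 2) * 2 ^ (sl.2 * 2 ^ y.unpair.2))))
    (comp_and (comp_le ck (comp_pow two c1)) (comp_and
      (comp_le (comp_mul (comp_pow ck (comp_sub cg two)) (comp_pow two
        (comp_mul c2 (comp_pow two cu)))) (comp_pow two (comp_mul c1 (comp_sub cg two))))
      (comp_le (comp_pow two (comp_mul c1 (comp_add cg two)))
        (comp_mul (comp_pow (comp_add ck two) (comp_add cg two)) (comp_pow two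
        (comp_mul c2 (comp_pow two cu))))))).to₂ (by
      rintro ⟨s, l⟩
      set R : ℝ := (2:ℝ) ^ (-(l:ℝ) / T) with hR
      have hR0 : 0 < R := by positivity
      have hR1 : R ≤ 1 := by
        apply Real.rpow_le_one_of_one_le_of_nonpos (by norm_num)
        rw [neg_div]; have : 0 ≤ (l:ℝ) / T := by positivity
        linarith
      have hRT : R ^ T = ((2:ℝ) ^ l)⁻¹ := two_root T hT0 l
      set r : ℝ := 2 ^ s * R with hr
      have hr0 : 0 < r := by positivity
      have hc0 : 0 < ⌈r⌉₊ := Nat.ceil_pos.2 hr0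
      obtain ⟨k, hk⟩ : ∃ k, ⌈r⌉₊ = k + 1 := ⟨⌈r⌉₊ - 1, by omega⟩
      have hk1 : (k:ℝ) < r := Nat.lt_ceil.1 (by omega)
      have hk2 : r ≤ k + 1 := by have := Nat.le_ceil r; rw [hk] at this; exact_mod_cast this
      have hk3 : k ≤ 2 ^ s := by
        have : (k:ℝ) ≤ 2 ^ s := hk1.le.trans (by rw [hr]; exact mul_le_of_le_one_right (by positivity) hR1)
        exact_mod_cast this
      have hx : (k:ℝ) / 2 ^ s < R := by rw [div_lt_iff₀ (by positivity)]; linarith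
      have hy : R < ((k + 2 : ℕ):ℝ) / 2 ^ s := by
        rw [lt_div_iff₀ (by positivity)]; push_cast; linarith
      have hxT : ((k:ℝ) / 2 ^ s) ^ T < ((2:ℝ) ^ l)⁻¹ := by
        rw [← hRT]; exact Real.rpow_lt_rpow (by positivity) hx hT0
      have hyT : ((2:ℝ) ^ l)⁻¹ < (((k + 2 : ℕ):ℝ) / 2 ^ s) ^ T := by
        rw [← hRT]; exact Real.rpow_lt_rpow (by positivity) hy hT0
      have t1 : Filter.Tendsto (fun u => ((g u - 2 : ℕ) : ℝ) / 2 ^ u) Filter.atTop (nhds T) := by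
        apply tendsto_approx
        intro u
        have := abs_le.1 (hgT u)
        rcases le_or_gt 2 (g u) with h2 | h2
        · rw [Nat.cast_sub h2, abs_le]; push_cast; constructor <;> linarith [this.1, this.2]
        · have e : g u - 2 = 0 := by omega
          have h3 : (g u : ℝ) < 2 := by exact_mod_cast h2
          have : 0 < T * 2 ^ u := by positivity
          rw [e, abs_le]; push_cast; constructor <;> linarith [this]
      have t2 : Filter.Tendsto (fun u => ((g u + 2 : ℕ) : ℝ) / 2 ^ u) Filter.atTop (nhds T) := by
        apply tendsto_approx
        intro u
        have := abs_le.1 (hgT u)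
        rw [abs_le]; push_cast; constructor <;> linarith [this.1, this.2]
      have u1 := ((Real.continuousAt_const_rpow' (a := (k:ℝ) / 2 ^ s) hT0.ne').tendsto.comp
        t1).eventually_lt_const hxT
      have u2 := ((Real.continuousAt_const_rpow' (a := ((k + 2 : ℕ):ℝ) / 2 ^ s) hT0.ne').tendsto.comp
        t2).eventually_const_lt hyT
      obtain ⟨u, hu1, hu2⟩ := (u1.and u2).exists
      refine ⟨Nat.pair k u, ?_⟩
      simp only [Bool.and_eq_true, decide_eq_true_eq, Nat.unpair_pair]
      refine ⟨hk3, ?_, ?_⟩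
      · rw [cast_le_iff1, ← root_le_iff _ (by positivity)]; exact hu1.le
      · rw [cast_le_iff2, ← le_root_iff _ (by positivity)]; exact hu2.le)
  refine ⟨fun s l => (h (s, l)).unpair.1, Computable.fst.comp (Primrec.unpair.to_comp.comp hh),
    fun s l => ?_⟩
  have := hspec (s, l)
  simp only [Bool.and_eq_true, decide_eq_true_eq] at this
  obtain ⟨h1, h2, h3⟩ := this
  set k := (h (s, l)).unpair.1
  set u := (h (s, l)).unpair.2
  set R : ℝ := (2:ℝ) ^ (-(l:ℝ) / T) with hR
  have hR0 : 0 < R := by positivity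
  have hR1 : R ≤ 1 := by
    apply Real.rpow_le_one_of_one_le_of_nonpos (by norm_num)
    rw [neg_div]; have : 0 ≤ (l:ℝ) / T := by positivity
    linarith
  have hRT : R ^ T = ((2:ℝ) ^ l)⁻¹ := two_root T hT0 l
  rw [cast_le_iff1, ← root_le_iff _ (by positivity)] at h2
  rw [cast_le_iff2, ← le_root_iff _ (by positivity)] at h3
  have hb := abs_le.1 (hgT u)
  constructor
  · rw [mul_comm, ← div_le_iff₀ (by positivity)]
    rw [← Real.rpow_le_rpow_iff (by positivity) hR0.le hT0, hRT]
    refine le_trans (Real.rpow_le_rpow_of_exponent_ge' (by positivity) ?_ (by positivity) ?_) h2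
    · rw [div_le_one (by positivity)]; exact_mod_cast h1
    · rw [div_le_iff₀ (by positivity)]
      rcases le_or_gt 2 (g u) with h2 | h2
      · rw [Nat.cast_sub h2]; push_cast; linarith [hb.1, hb.2]
      · have e : g u - 2 = 0 := by omega
        rw [e]; push_cast; positivity
  · rcases le_or_gt 1 (((k + 2 : ℕ):ℝ) / 2 ^ s) with hy | hy
    · rw [one_le_div (by positivity)] at hy
      push_cast at hy
      exact le_trans (mul_le_of_le_one_right (by positivity) hR1) hy
    · have : R ≤ ((k + 2 : ℕ):ℝ) / 2 ^ s := by
        rw [← Real.rpow_le_rpow_iff hR0.le (by positivity) hT0, hRT]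
        refine le_trans h3 (Real.rpow_le_rpow_of_exponent_ge' (by positivity) hy.le hT0.le ?_)
        rw [le_div_iff₀ (by positivity)]
        push_cast; linarith [hb.1, hb.2]
      rw [le_div_iff₀ (by positivity)] at this
      push_cast at this
      linarith

open Encodable

theorem exists_L (T : ℝ) (hT0 : 0 < T) (g : ℕ → ℕ) (hg : Computable g)
    (hgT : ∀ u, |T * 2 ^ u - g u| ≤ 2) :
    ∃ L : ℕ → ℕ, Computable L ∧ ∀ n : ℕ, T * n ≤ L n ∧ (L n : ℝ) ≤ T * n + 5 := by
  refine ⟨fun n => n * g n / 2 ^ n + 3, comp_add (comp_div (comp_mul Computable.id hg)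
    (comp_pow (Computable.const 2) Computable.id)) (Computable.const 3), fun n => ?_⟩
  have h1 : ((n * g n / 2 ^ n : ℕ) : ℝ) = ⌊((n * g n : ℕ) : ℝ) / ((2 ^ n : ℕ) : ℝ)⌋₊ := by
    rw [Nat.floor_div_eq_div]
  set x : ℝ := ((n * g n : ℕ) : ℝ) / ((2 ^ n : ℕ) : ℝ) with hx
  have hx0 : 0 ≤ x := by positivity
  have a1 := Nat.floor_le hx0
  have a2 := Nat.lt_floor_add_one x
  have hn : (n:ℝ) ≤ 2 ^ n := by exact_mod_cast (Nat.lt_two_pow_self (n := n)).le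
  have hb := abs_le.1 (hgT n)
  have e : x * 2 ^ n = n * g n := by rw [hx]; push_cast; field_simp
  have hp : (0:ℝ) < 2 ^ n := by positivity
  have hn0 : (0:ℝ) ≤ n := by positivity
  have b1 : T * n ≤ x + 2 := by
    have : T * n * 2 ^ n ≤ (x + 2) * 2 ^ n := by rw [add_mul, e]; nlinarith [hb.1, hb.2]
    exact le_of_mul_le_mul_right this hp
  have b2 : x ≤ T * n + 2 := by
    have : x * 2 ^ n ≤ (T * n + 2) * 2 ^ n := by rw [e]; nlinarith [hb.1, hb.2]
    exact le_of_mul_le_mul_right this hp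
  push_cast [h1]
  constructor <;> linarith

theorem geom_part_le (τ : ℝ) (h0 : 0 ≤ τ) (h1 : τ < 1) (k : ℕ) :
    ∑ n ∈ Finset.range k, τ ^ n ≤ (1 - τ)⁻¹ := by
  rw [← tsum_geometric_of_lt_one h0 h1]
  exact (summable_geometric_of_lt_one h0 h1).sum_le_tsum _ (fun _ _ => by positivity)

theorem geom_bound (T : ℝ) (hT0 : 0 < T) (hT1 : T < 1) :
    ∃ C : ℝ, 0 < C ∧ ∀ J l : ℕ, ∑ n ∈ Finset.range J,
      (2:ℝ) ^ (-(T * n)) * min 1 (2 ^ n * (2:ℝ) ^ (-(l:ℝ) / T)) ≤ C * ((2:ℝ) ^ l)⁻¹ := by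
  set τ : ℝ := max ((2:ℝ) ^ (-T)) ((2:ℝ) ^ (-(1 - T))) with hτ
  have hτ0 : 0 < τ := lt_max_of_lt_left (by positivity)
  have hτ1 : τ < 1 := max_lt (Real.rpow_lt_one_of_one_lt_of_neg (by norm_num) (by linarith))
    (Real.rpow_lt_one_of_one_lt_of_neg (by norm_num) (by linarith))
  have hi : 0 < (1 - τ)⁻¹ := inv_pos.2 (by linarith)
  refine ⟨(1 - τ)⁻¹ + (1 - τ)⁻¹, by positivity, fun J l => ?_⟩
  set K : ℝ := (l:ℝ) / T with hK
  have hK0 : 0 ≤ K := by positivity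
  set k := ⌈K⌉₊ with hk
  have hk1 : K ≤ k := Nat.le_ceil K
  have hk2 : (k:ℝ) < K + 1 := Nat.ceil_lt_add_one hK0
  have hTK : T * K = l := by rw [hK]; field_simp
  set F : ℕ → ℝ := fun n => (2:ℝ) ^ (-(T * n)) * min 1 (2 ^ n * (2:ℝ) ^ (-(l:ℝ) / T)) with hF
  have hF0 : ∀ n, 0 ≤ F n := fun n => by positivity
  have hl : ((2:ℝ) ^ l)⁻¹ = (2:ℝ) ^ (-(l:ℝ)) := by
    rw [Real.rpow_neg (by norm_num), Real.rpow_natCast]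
  have big : ∀ j : ℕ, F (k + j) ≤ ((2:ℝ) ^ l)⁻¹ * τ ^ j := by
    intro j
    calc F (k + j) ≤ (2:ℝ) ^ (-(T * (k + j : ℕ))) * 1 := by
          simp only [hF]; gcongr; exact min_le_left _ _
      _ ≤ (2:ℝ) ^ (-(l:ℝ)) * ((2:ℝ) ^ (-T)) ^ j := by
          rw [mul_one, ← Real.rpow_natCast, ← Real.rpow_mul (by norm_num),
            ← Real.rpow_add (by norm_num)]
          apply Real.rpow_le_rpow_of_exponent_le (by norm_num)
          push_cast; nlinarith
      _ ≤ _ := by rw [hl]; gcongr; exact le_max_left _ _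
  have small : ∀ j : ℕ, j < k → F (k - 1 - j) ≤ ((2:ℝ) ^ l)⁻¹ * τ ^ j := by
    intro j hj
    have hc : ((k - 1 - j : ℕ) : ℝ) = k - 1 - j := by
      rw [Nat.sub_sub, Nat.cast_sub (by omega)]; push_cast; ring
    calc F (k - 1 - j) ≤ (2:ℝ) ^ (-(T * (k - 1 - j : ℕ))) *
          (2 ^ (k - 1 - j) * (2:ℝ) ^ (-(l:ℝ) / T)) := by
          simp only [hF]; gcongr; exact min_le_right _ _
      _ ≤ (2:ℝ) ^ (-(l:ℝ)) * ((2:ℝ) ^ (-(1 - T))) ^ j := by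
          rw [← Real.rpow_natCast, ← Real.rpow_natCast, ← Real.rpow_mul (by norm_num),
            ← Real.rpow_add (by norm_num),
            ← Real.rpow_add (by norm_num), ← Real.rpow_add (by norm_num)]
          apply Real.rpow_le_rpow_of_exponent_le (by norm_num)
          rw [hc, neg_div, ← hK]
          nlinarith
      _ ≤ _ := by rw [hl]; gcongr; exact le_max_right _ _
  calc ∑ n ∈ Finset.range J, F n ≤ ∑ n ∈ Finset.range (k + J), F n :=
        Finset.sum_le_sum_of_subset_of_nonneg (by
          intro x; simp only [Finset.mem_range]; omega) (fun n _ _ => hF0 n)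
    _ = ∑ n ∈ Finset.range k, F n + ∑ n ∈ Finset.range J, F (k + n) := Finset.sum_range_add _ _ _
    _ = ∑ n ∈ Finset.range k, F (k - 1 - n) + ∑ n ∈ Finset.range J, F (k + n) := by
        rw [Finset.sum_range_reflect]
    _ ≤ ∑ n ∈ Finset.range k, ((2:ℝ) ^ l)⁻¹ * τ ^ n
        + ∑ n ∈ Finset.range J, ((2:ℝ) ^ l)⁻¹ * τ ^ n := by
        gcongr with n hn n hn
        · exact small n (Finset.mem_range.1 hn)
        · exact big n
    _ ≤ _ := by
        rw [← Finset.mul_sum, ← Finset.mul_sum, add_mul, mul_comm _ (((2:ℝ) ^ l)⁻¹)]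
        gcongr <;> exact geom_part_le τ hτ0.le hτ1 _

theorem count_floor (D : ℕ → Finset ℕ) (hD : Monotone D) (a : ℕ → ℝ) (ha : ∀ i, 0 ≤ a i)
    (N : ℕ) :
    ((Finset.image (fun t => ⌊∑ i ∈ D t, a i⌋) (Finset.range (N + 1))).card : ℝ)
      + Int.fract (∑ i ∈ D N, a i) ≤ 2 + 2 * ∑ i ∈ D N, min 1 (a i) := by
  induction N with
  | zero =>
    have h1 : 0 ≤ ∑ i ∈ D 0, min 1 (a i) :=
      Finset.sum_nonneg fun i _ => le_min zero_le_one (ha i)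
    have := Int.fract_lt_one (∑ i ∈ D 0, a i)
    simp
    linarith
  | succ N ih =>
    rw [Finset.range_add_one, Finset.image_insert]
    have hsub := hD (Nat.le_add_right N 1)
    set E := D (N + 1) \ D N with hE
    have e1 : ∑ i ∈ D (N + 1), a i = ∑ i ∈ D N, a i + ∑ i ∈ E, a i := by
      rw [add_comm (∑ i ∈ D N, _), Finset.sum_sdiff hsub]
    have e2 : ∑ i ∈ D (N + 1), min 1 (a i) = ∑ i ∈ D N, min 1 (a i) + ∑ i ∈ E, min 1 (a i) := by
      rw [add_comm (∑ i ∈ D N, _), Finset.sum_sdiff hsub]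
    set I := Finset.image (fun t => ⌊∑ i ∈ D t, a i⌋) (Finset.range (N + 1)) with hI
    have hmem : ⌊∑ i ∈ D N, a i⌋ ∈ I := Finset.mem_image.2 ⟨N, by simp, rfl⟩
    have hc : ((insert ⌊∑ i ∈ D (N + 1), a i⌋ I).card : ℝ) ≤ I.card + 1 := by
      exact_mod_cast Finset.card_insert_le _ _
    have hδ0 : 0 ≤ ∑ i ∈ E, min 1 (a i) :=
      Finset.sum_nonneg fun i _ => le_min zero_le_one (ha i)
    have f1 := Int.fract_lt_one (∑ i ∈ D (N + 1), a i)
    have f0 := Int.fract_nonneg (∑ i ∈ D N, a i)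
    rcases le_or_gt 1 (∑ i ∈ E, min 1 (a i)) with h | h
    · rw [e2]; linarith
    · have e3 : ∑ i ∈ E, a i = ∑ i ∈ E, min 1 (a i) := by
        refine Finset.sum_congr rfl fun i hi => ?_
        have : min 1 (a i) ≤ ∑ i ∈ E, min 1 (a i) :=
          Finset.single_le_sum (f := fun i => min 1 (a i))
            (fun i _ => le_min zero_le_one (ha i)) hi
        have h2 : min 1 (a i) < 1 := this.trans_lt h
        rcases min_lt_iff.1 h2 with h3 | h3
        · exact absurd h3 (lt_irrefl _)
        · exact (min_eq_right h3.le).symm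
      by_cases hf : ⌊∑ i ∈ D (N + 1), a i⌋ = ⌊∑ i ∈ D N, a i⌋
      · rw [hf, Finset.insert_eq_of_mem hmem]
        have g1 := Int.floor_add_fract (∑ i ∈ D (N + 1), a i)
        have g2 := Int.floor_add_fract (∑ i ∈ D N, a i)
        rw [hf] at g1
        rw [e2]; linarith
      · have g1 := Int.floor_add_fract (∑ i ∈ D (N + 1), a i)
        have g2 := Int.floor_add_fract (∑ i ∈ D N, a i)
        have hle : ⌊∑ i ∈ D N, a i⌋ ≤ ⌊∑ i ∈ D (N + 1), a i⌋ := by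
          apply Int.floor_le_floor; rw [e1, e3]; linarith
        have hlt : ⌊∑ i ∈ D N, a i⌋ + 1 ≤ ⌊∑ i ∈ D (N + 1), a i⌋ :=
          lt_of_le_of_ne hle (Ne.symm hf)
        have hlt' : (⌊∑ i ∈ D N, a i⌋ : ℝ) + 1 ≤ ⌊∑ i ∈ D (N + 1), a i⌋ := by exact_mod_cast hlt
        rw [e2]; linarith

open Encodable

theorem weight_bound (T : ℝ) (hT0 : 0 < T) (hT1 : T < 1) :
    ∃ c : ℕ, ∀ (D : ℕ → Finset ℕ) (_ : Monotone D) (len : ℕ → ℕ)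
      (_ : ∀ t, ∑ i ∈ D t, ((2:ℝ) ^ len i)⁻¹ ≤ 1)
      (key : ℕ → ℕ → ℕ)
      (_ : ∀ t n, n ≤ t → (key t n : ℤ) = ⌊∑ i ∈ D t, 2 ^ n * (2:ℝ) ^ (-(len i : ℝ) / T)⌋ ∨
        (key t n : ℤ) + 1 = ⌊∑ i ∈ D t, 2 ^ n * (2:ℝ) ^ (-(len i : ℝ) / T)⌋)
      (L : ℕ → ℕ) (_ : ∀ n : ℕ, T * n ≤ L n)
      (valid : ℕ → ℕ → Bool)
      (_ : ∀ n t, valid n t = true → n ≤ t ∧ ∀ t' < t, n ≤ t' → key t' n ≠ key t n) (N : ℕ),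
      ∑ n ∈ Finset.range N, ∑ t ∈ Finset.range N,
        ((valid n t).toNat : ℝ) * ((2:ℝ) ^ (c + L n))⁻¹ ≤ 1 := by
  obtain ⟨C, hC, hgeom⟩ := geom_bound T hT0 hT1
  obtain ⟨c, hc⟩ := pow_unbounded_of_one_lt (8 * C) (one_lt_two : (1:ℝ) < 2)
  refine ⟨c, fun D hD len hK key hkey L hL valid hvalid N => ?_⟩
  set a : ℕ → ℕ → ℝ := fun n i => 2 ^ n * (2:ℝ) ^ (-(len i : ℝ) / T) with ha
  have ha0 : ∀ n i, 0 ≤ a n i := fun n i => by positivity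
  have hcount : ∀ n, (∑ t ∈ Finset.range N, ((valid n t).toNat : ℝ)) ≤
      2 * (2 + 2 * ∑ i ∈ D N, min 1 (a n i)) := by
    intro n
    set I := Finset.image (fun t => ⌊∑ i ∈ D t, a n i⌋) (Finset.range (N + 1)) with hI
    have h1 := count_floor D hD (a n) (ha0 n) N
    rw [← hI] at h1
    have h2 : (∑ t ∈ Finset.range N, ((valid n t).toNat)) =
        ((Finset.range N).filter (fun t => valid n t = true)).card := by
      rw [Finset.card_filter]
      refine Finset.sum_congr rfl fun t _ => ?_
      cases valid n t <;> rfl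
    have h3 : ((Finset.range N).filter (fun t => valid n t = true)).card ≤
        (I ∪ I.image (fun z => z - 1)).card := by
      apply Finset.card_le_card_of_injOn (fun t => (key t n : ℤ))
      · intro t ht
        simp only [Finset.coe_filter, Finset.mem_range, Set.mem_ofPred_eq] at ht
        have hm : ⌊∑ i ∈ D t, a n i⌋ ∈ I :=
          Finset.mem_image.2 ⟨t, Finset.mem_range.2 (by omega), rfl⟩
        simp only [Finset.mem_coe, Finset.mem_union]
        rcases hkey t n (hvalid n t ht.2).1 with h | h
        · left; rw [h]; exact hm
        · right; refine Finset.mem_image.2 ⟨_, hm, ?_⟩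
          simp only [ha]; rw [← h]; ring
      · intro t ht t' ht' heq
        simp only [Finset.coe_filter, Finset.mem_range, Set.mem_ofPred_eq] at ht ht'
        have heq2 : (key t n : ℤ) = (key t' n : ℤ) := heq
        have heq' : key t n = key t' n := by exact_mod_cast heq2
        have v1 := hvalid n t ht.2
        have v2 := hvalid n t' ht'.2
        rcases lt_trichotomy t t' with h | h | h
        · exact absurd heq' (v2.2 t h v1.1)
        · exact h
        · exact absurd heq'.symm (v1.2 t' h v2.1)
    have h4 : (I ∪ I.image (fun z => z - 1)).card ≤ 2 * I.card := by
      refine (Finset.card_union_le _ _).trans ?_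
      have := Finset.card_image_le (s := I) (f := fun z => z - 1)
      omega
    have h5 : (∑ t ∈ Finset.range N, ((valid n t).toNat : ℝ)) ≤ 2 * I.card := by
      have := h2.trans_le (h3.trans h4)
      exact_mod_cast this
    have h6 := Int.fract_nonneg (∑ i ∈ D N, a n i)
    linarith
  have hw : ∀ n, ((2:ℝ) ^ (c + L n))⁻¹ ≤ ((2:ℝ) ^ c)⁻¹ * (2:ℝ) ^ (-(T * n)) := by
    intro n
    rw [pow_add, mul_inv]
    gcongr
    rw [← Real.rpow_natCast, ← Real.rpow_neg (by norm_num)]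
    exact Real.rpow_le_rpow_of_exponent_le (by norm_num) (by linarith [hL n])
  have g0 : ∑ n ∈ Finset.range N, (2:ℝ) ^ (-(T * n)) ≤ C := by
    have := hgeom N 0
    simp only [Nat.cast_zero, neg_zero, zero_div, Real.rpow_zero, mul_one, pow_zero, inv_one] at this
    refine le_trans (Finset.sum_le_sum fun n _ => ?_) this
    rw [min_eq_left (one_le_pow₀ (by norm_num)), mul_one]
  have g1 : ∑ n ∈ Finset.range N, (2:ℝ) ^ (-(T * n)) * ∑ i ∈ D N, min 1 (a n i) ≤ C := by
    simp only [Finset.mul_sum]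
    rw [Finset.sum_comm]
    calc _ ≤ ∑ i ∈ D N, C * ((2:ℝ) ^ len i)⁻¹ := Finset.sum_le_sum fun i _ => hgeom N (len i)
      _ = C * ∑ i ∈ D N, ((2:ℝ) ^ len i)⁻¹ := by rw [Finset.mul_sum]
      _ ≤ C * 1 := by gcongr; exact hK N
      _ = C := mul_one C
  calc _ = ∑ n ∈ Finset.range N, (∑ t ∈ Finset.range N,
        ((valid n t).toNat : ℝ)) * ((2:ℝ) ^ (c + L n))⁻¹ := by simp only [Finset.sum_mul]
    _ ≤ ∑ n ∈ Finset.range N, (2 * (2 + 2 * ∑ i ∈ D N, min 1 (a n i))) *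
        (((2:ℝ) ^ c)⁻¹ * (2:ℝ) ^ (-(T * n))) := by
        refine Finset.sum_le_sum fun n _ => ?_
        exact mul_le_mul (hcount n) (hw n) (by positivity)
          (le_trans (Finset.sum_nonneg fun _ _ => by positivity) (hcount n))
    _ = ((2:ℝ) ^ c)⁻¹ * (4 * ∑ n ∈ Finset.range N, (2:ℝ) ^ (-(T * n)) +
        4 * ∑ n ∈ Finset.range N, (2:ℝ) ^ (-(T * n)) * ∑ i ∈ D N, min 1 (a n i)) := by
        rw [Finset.mul_sum _ _ (4:ℝ), Finset.mul_sum _ _ (4:ℝ), ← Finset.sum_add_distrib,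
          Finset.mul_sum]
        refine Finset.sum_congr rfl fun n _ => ?_
        ring
    _ ≤ ((2:ℝ) ^ c)⁻¹ * (4 * C + 4 * C) := by gcongr
    _ ≤ 1 := by
        rw [inv_mul_le_iff₀ (by positivity)]; linarith

open Encodable

/-- binary value of a word -/
def bval (p : List Bool) : ℕ := p.foldl (fun a b => 2 * a + b.toNat) 0

theorem bval_foldl (p : List Bool) (x : ℕ) :
    p.foldl (fun a b => 2 * a + b.toNat) x = x * 2 ^ p.length + bval p := by
  unfold bval
  induction p generalizing x with
  | nil => simp
  | cons b p ih =>
    simp only [List.foldl_cons, List.length_cons]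
    rw [ih, ih (2 * 0 + b.toNat)]; ring

theorem bval_append (p r : List Bool) : bval (p ++ r) = bval p * 2 ^ r.length + bval r := by
  conv_lhs => unfold bval
  rw [List.foldl_append, bval_foldl]; rfl

theorem bval_lt (p : List Bool) : bval p < 2 ^ p.length := by
  induction p using List.reverseRecOn with
  | nil => simp [bval]
  | append_singleton p b ih =>
    rw [bval_append, List.length_append, pow_add]
    have : bval [b] < 2 := by cases b <;> simp [bval]
    simp only [List.length_singleton, pow_one]
    omega

theorem exists_bval (n v : ℕ) (h : v < 2 ^ n) : ∃ p : List Bool, p.length = n ∧ bval p = v := by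
  induction n generalizing v with
  | zero => exact ⟨[], rfl, by simp at h; simp [bval, h]⟩
  | succ n ih =>
    obtain ⟨p, hp, hv⟩ := ih (v / 2) (by rw [pow_succ] at h; omega)
    refine ⟨p ++ [decide (v % 2 = 1)], by simp [hp], ?_⟩
    rw [bval_append, hv]
    rcases Nat.mod_two_eq_zero_or_one v with h | h <;> simp [bval, h] <;> omega

theorem comp_bval : Computable bval := by
  have : Primrec bval := by
    unfold bval
    exact Primrec.list_foldl (h := fun (_ : List Bool) (z : ℕ × Bool) => 2 * z.1 + z.2.toNat) Primrec.id (Primrec.const 0)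
      (Primrec.nat_add.comp (Primrec.nat_mul.comp (Primrec.const 2)
        (Primrec.fst.comp Primrec.snd)) ((Primrec.dom_finite Bool.toNat).comp
          (Primrec.snd.comp Primrec.snd))).to₂
  exact this.to_comp

theorem kraft_chaitin (valid : ℕ → Bool) (l : ℕ → ℕ) (x : ℕ → List Bool)
    (hv : Computable valid) (hl : Computable l) (hx : Computable x)
    (hsum : ∀ J, ∑ i ∈ Finset.range J, ((valid i).toNat : ℝ) * ((2:ℝ) ^ l i)⁻¹ ≤ 1) :
    ∃ M : List Bool →. List Bool, IsPrefixFreeMachine M ∧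
      ∀ j, valid j = true → ∃ p : List Bool, p.length = l j + 1 ∧ M p = Part.some (x j) := by
  set B : ℕ → ℕ := fun j => ∑ i ∈ Finset.range (j + 1), l i + 1 with hB
  set E : ℕ → ℕ := fun j => ∑ i ∈ Finset.range j, (valid i).toNat * 2 ^ (B j - l i) with hE
  set val : ℕ → ℕ := fun j => E j / 2 ^ (B j - (l j + 1)) + 1 with hval
  set S : ℕ → ℝ := fun j => ∑ i ∈ Finset.range j, ((valid i).toNat : ℝ) * ((2:ℝ) ^ l i)⁻¹ with hS
  have hlB : ∀ i j, i ≤ j → l i + 1 ≤ B j := by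
    intro i j hij
    have : l i ≤ ∑ i ∈ Finset.range (j + 1), l i :=
      Finset.single_le_sum (fun _ _ => Nat.zero_le _) (Finset.mem_range.2 (by omega))
    simp only [hB]; omega
  have hES : ∀ j, (E j : ℝ) = S j * 2 ^ B j := by
    intro j
    simp only [hE, hS]
    push_cast
    rw [Finset.sum_mul]
    refine Finset.sum_congr rfl fun i hi => ?_
    have h1 := hlB i j (Finset.mem_range.1 hi).le
    rw [mul_assoc]
    congr 1
    rw [eq_inv_mul_iff_mul_eq₀ (by positivity), ← pow_add]
    congr 1; omega
  have hvalS : ∀ j, (val j : ℝ) = ⌊S j * 2 ^ (l j + 1)⌋₊ + 1 := by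
    intro j
    simp only [hval]
    push_cast
    congr 1
    have : S j * 2 ^ (l j + 1) = (E j : ℝ) / ((2 ^ (B j - (l j + 1)) : ℕ) : ℝ) := by
      rw [hES, eq_div_iff (by positivity)]
      push_cast
      rw [mul_assoc, ← pow_add]
      congr 2
      have := hlB j j le_rfl; omega
    rw [this, Nat.floor_div_eq_div]
  have hS0 : ∀ j, 0 ≤ S j := fun j => Finset.sum_nonneg fun _ _ => by positivity
  have hSmono : Monotone S := by
    intro i j hij
    exact Finset.sum_le_sum_of_subset_of_nonneg (by intro x; simp only [Finset.mem_range]; omega)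
      (fun _ _ _ => by positivity)
  have hSstep : ∀ i j, i < j → valid i = true → S i + ((2:ℝ) ^ l i)⁻¹ ≤ S j := by
    intro i j hij hvi
    have := hSmono (Nat.succ_le_of_lt hij)
    refine le_trans (le_of_eq ?_) this
    simp only [hS]
    rw [Nat.succ_eq_add_one, Finset.sum_range_succ, hvi]; simp
  have hlow : ∀ j, S j * 2 ^ (l j + 1) < val j := fun j => by
    rw [hvalS]; exact Nat.lt_floor_add_one _
  have hupp : ∀ j, (val j : ℝ) + 1 ≤ (S j + ((2:ℝ) ^ l j)⁻¹) * 2 ^ (l j + 1) := fun j => by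
    rw [hvalS, add_mul]
    have h1 := Nat.floor_le (a := S j * 2 ^ (l j + 1)) (mul_nonneg (hS0 j) (by positivity))
    have h2 : ((2:ℝ) ^ l j)⁻¹ * 2 ^ (l j + 1) = 2 := by rw [pow_succ]; field_simp
    rw [h2]; linarith
  set m : List Bool → ℕ → Bool := fun p j =>
    valid j && (decide (l j + 1 = p.length) && decide (val j = bval p)) with hm
  have hmiff : ∀ p j, m p j = true ↔ valid j = true ∧ l j + 1 = p.length ∧ val j = bval p := by
    intro p j; simp [hm]
  have key : ∀ p q j k, p <+: q → m p j = true → m q k = true → j = k := by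
    rintro p q j k ⟨r, rfl⟩ h1 h2
    obtain ⟨vj, lj, ej⟩ := (hmiff _ _).1 h1
    obtain ⟨vk, lk, ek⟩ := (hmiff _ _).1 h2
    rw [bval_append] at ek
    have hr := bval_lt r
    have hlk : l k + 1 = l j + 1 + r.length := by rw [lk, lj, List.length_append]
    have k1 : (val j : ℝ) * 2 ^ r.length ≤ val k := by
      have : val j * 2 ^ r.length ≤ val k := by rw [ek, ej]; omega
      exact_mod_cast this
    have k2 : (val k : ℝ) + 1 ≤ (val j + 1) * 2 ^ r.length := by
      have : val k + 1 ≤ (val j + 1) * 2 ^ r.length := by rw [ek, ej, add_mul]; omega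
      exact_mod_cast this
    have a1 := hlow j
    have a2 := hlow k
    have b1 := hupp j
    have b2 := hupp k
    rw [hlk, pow_add, ← mul_assoc] at a2 b2
    have hR : (0:ℝ) < 2 ^ r.length := by positivity
    have hP : (0:ℝ) < 2 ^ (l j + 1) := by positivity
    rcases lt_trichotomy j k with h | h | h
    · exfalso
      have s := hSstep j k h vj
      have : (S j + ((2:ℝ) ^ l j)⁻¹) * 2 ^ (l j + 1) ≤ S k * 2 ^ (l j + 1) := by gcongr
      have : ((val j : ℝ) + 1) * 2 ^ r.length ≤ S k * 2 ^ (l j + 1) * 2 ^ r.length := by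
        gcongr; exact b1.trans this
      linarith
    · exact h
    · exfalso
      have s := hSstep k j h vk
      have : (S k + ((2:ℝ) ^ l k)⁻¹) * 2 ^ (l j + 1) * 2 ^ r.length ≤
        S j * 2 ^ (l j + 1) * 2 ^ r.length := by gcongr
      have : S j * 2 ^ (l j + 1) * 2 ^ r.length ≤ val j * 2 ^ r.length := by gcongr
      linarith
  have cB : Computable B := comp_add (comp_sum (f := fun _ i => l i) (hl.comp Computable.snd).to₂
    (comp_add Computable.id (Computable.const 1))) (Computable.const 1)
  have cE : Computable E := comp_sum (f := fun j i => (valid i).toNat * 2 ^ (B j - l i))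
    (comp_mul (comp_toNat (hv.comp Computable.snd)) (comp_pow (Computable.const 2)
      (comp_sub (cB.comp Computable.fst) (hl.comp Computable.snd)))).to₂ Computable.id
  have cval : Computable val := comp_add (comp_div cE (comp_pow (Computable.const 2)
    (comp_sub cB (comp_add hl (Computable.const 1))))) (Computable.const 1)
  have cm : Computable₂ m := (comp_and (hv.comp Computable.snd) (comp_and
    (comp_eq (comp_add (hl.comp Computable.snd) (Computable.const 1))
      (Computable.list_length.comp Computable.fst))
    (comp_eq (cval.comp Computable.snd) (comp_bval.comp Computable.fst)))).to₂
  have hrf : Partrec fun p => Nat.rfind (fun j => (Part.some (m p j) : Part Bool)) :=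
    Partrec.rfind (p := fun p j => (Part.some (m p j))) cm
  have hM : Partrec fun p => (Nat.rfind (fun j => (Part.some (m p j) : Part Bool))).map x :=
    hrf.map (hx.comp Computable.snd).to₂
  have hdom : ∀ p, ((Nat.rfind (fun j => (Part.some (m p j) : Part Bool))).map x).Dom →
      ∃ j, m p j = true := by
    intro p hp
    have hp' : (Nat.rfind (fun j => (Part.some (m p j) : Part Bool))).Dom := hp
    obtain ⟨j, hj⟩ := Part.dom_iff_mem.1 hp'
    have := (Nat.mem_rfind.1 hj).1
    exact ⟨j, (Part.mem_some_iff.1 this).symm⟩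
  refine ⟨fun p => (Nat.rfind (fun j => (Part.some (m p j) : Part Bool))).map x, ⟨hM, ?_⟩, ?_⟩
  · intro p q hp hq hpq
    obtain ⟨j, hj⟩ := hdom p hp
    obtain ⟨k, hk⟩ := hdom q hq
    have := key p q j k hpq hj hk
    subst this
    have e1 := ((hmiff _ _).1 hj).2.1
    have e2 := ((hmiff _ _).1 hk).2.1
    exact hpq.eq_of_length (by omega)
  · intro j hj
    obtain ⟨p, hp, hpv⟩ := exists_bval (l j + 1) (val j) (by
      have h1 := hupp j
      have h2 : S j + ((2:ℝ) ^ l j)⁻¹ ≤ 1 := (hSstep j (j+1) (by omega) hj).trans (hsum _)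
      have h3 : (S j + ((2:ℝ) ^ l j)⁻¹) * 2 ^ (l j + 1) ≤ 1 * 2 ^ (l j + 1) := by gcongr
      have h4 : (val j : ℝ) < 2 ^ (l j + 1) := by linarith
      exact_mod_cast h4)
    refine ⟨p, hp, ?_⟩
    have hmj : m p j = true := (hmiff _ _).2 ⟨hj, hp.symm, hpv.symm⟩
    have : Nat.rfind (fun j => (Part.some (m p j) : Part Bool)) = Part.some j := by
      refine Part.eq_some_iff.2 (Nat.mem_rfind.2 ⟨Part.mem_some_iff.2 hmj.symm, ?_⟩)
      intro k hk
      refine Part.mem_some_iff.2 ?_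
      by_contra hne
      have : m p k = true := by
        cases h : m p k
        · exact absurd h.symm hne
        · rfl
      have := key p p k j (List.prefix_refl p) this hmj
      omega
    change Part.map x (Nat.rfind (fun j => (Part.some (m p j) : Part Bool))) = _
    rw [this, Part.map_some]


theorem pre_succ (X : ℕ → Bool) (n : ℕ) : pre X (n + 1) = pre X n ++ [X n] := by
  simp [pre, List.range_succ]

theorem predict_zero (X : ℕ → Bool) (N : ℕ) (h : ∀ n, N ≤ n → X n = false) :
    FiniteStateStronglyPredictable X := by
  set δ : Fin (N + 1) → Bool → Fin (N + 1) := fun q _ => ⟨min (q.1 + 1) N, by omega⟩ with hδ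
  have hst : ∀ n, ((pre X n).foldl δ 0).1 = min n N := by
    intro n
    induction n with
    | zero => simp [pre]
    | succ n ih =>
      rw [pre_succ, List.foldl_append]
      simp only [List.foldl_cons, List.foldl_nil, hδ]
      simp only [hδ] at ih
      rw [ih]; omega
  refine ⟨Fin (N + 1), inferInstance, δ, 0, fun q => if q.1 = N then some false else none, ?_, ?_⟩
  · intro n b hb
    simp only [hst] at hb
    split_ifs at hb with h1
    simp only [Option.some.injEq] at hb
    rw [← hb, h n (by omega)]
  · refine (Set.Ici_infinite N).mono fun n hn => ?_
    have : N ≤ n := hn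
    simp [hst, this]

/-- current run of zeros -/
def zrun (X : ℕ → Bool) : ℕ → ℕ
  | 0 => 0
  | n + 1 => if X n = true then 0 else zrun X n + 1

theorem zrun_spec (X : ℕ → Bool) (n : ℕ) : zrun X n ≤ n ∧
    ∀ k, k < zrun X n → X (n - zrun X n + k) = false := by
  induction n with
  | zero => simp [zrun]
  | succ n ih =>
    simp only [zrun]
    split_ifs with h
    · simp
    · refine ⟨by omega, fun k hk => ?_⟩
      rw [Nat.add_sub_add_right]
      rcases Nat.lt_succ_iff_lt_or_eq.1 hk with h1 | h1
      · exact ih.2 k h1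
      · subst h1
        rw [Nat.sub_add_cancel ih.1]
        simpa using h

theorem predict_run (X : ℕ → Bool) (m : ℕ) (h : ∀ n, ∃ k, k < m ∧ X (n + k) = true) :
    FiniteStateStronglyPredictable X := by
  have hlt : ∀ n, zrun X n < m := by
    intro n
    by_contra hc
    obtain ⟨k, hk, hX⟩ := h (n - zrun X n)
    rw [(zrun_spec X n).2 k (by omega)] at hX
    exact absurd hX (by simp)
  obtain ⟨K, hK, hK'⟩ : ∃ K, {n | zrun X n = K}.Infinite ∧ ¬ {n | zrun X n = K + 1}.Infinite := by
    by_contra! hc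
    obtain ⟨k, hk⟩ : ∃ k : Fin m, {n | zrun X n = k.1}.Infinite := by
      obtain ⟨y, hy⟩ := Finite.exists_infinite_fiber (fun n => (⟨zrun X n, hlt n⟩ : Fin m))
      refine ⟨y, ?_⟩
      rw [Set.infinite_coe_iff] at hy
      refine hy.mono fun n hn => ?_
      have : (⟨zrun X n, hlt n⟩ : Fin m) = y := hn
      exact congrArg Fin.val this
    have : ∀ j, {n | zrun X n = k.1 + j}.Infinite := by
      intro j
      induction j with
      | zero => exact hk
      | succ j ih => exact hc _ ih
    obtain ⟨n, hn⟩ := (this m).nonempty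
    have hn' : zrun X n = k.1 + m := hn
    have := hlt n
    omega
  obtain ⟨N, hN⟩ := (Set.not_infinite.1 hK').bddAbove
  have hpred : ∀ n, N < n → zrun X n = K → X n = true := by
    intro n hn hr
    by_contra hc
    have : zrun X (n + 1) = K + 1 := by simp [zrun, hc, hr]
    have := hN this
    omega
  set M := N + 1 with hM
  set δ : Fin (M + 1) × Fin (m + 1) → Bool → Fin (M + 1) × Fin (m + 1) := fun q b =>
    (⟨min (q.1.1 + 1) M, by omega⟩, if b = true then 0 else ⟨min (q.2.1 + 1) m, by omega⟩) with hδ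
  have hst : ∀ n, ((pre X n).foldl δ (0, 0)).1.1 = min n M ∧
      ((pre X n).foldl δ (0, 0)).2.1 = zrun X n := by
    intro n
    induction n with
    | zero => simp [pre, zrun]
    | succ n ih =>
      rw [pre_succ, List.foldl_append]
      generalize (pre X n).foldl δ (0, 0) = s at ih
      have := hlt (n + 1)
      have h2 : zrun X (n + 1) = if X n = true then 0 else zrun X n + 1 := rfl
      simp only [List.foldl_cons, List.foldl_nil, hδ]
      refine ⟨by rw [ih.1]; omega, ?_⟩
      split_ifs at h2 ⊢ with h1
      · simp [h2]
      · simp only [ih.2, h2]; omega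
  refine ⟨Fin (M + 1) × Fin (m + 1), inferInstance, δ, (0, 0),
    fun q => if q.1.1 = M ∧ q.2.1 = K then some true else none, ?_, ?_⟩
  · intro n b hb
    simp only [hst] at hb
    split_ifs at hb with h1
    simp only [Option.some.injEq] at hb
    rw [← hb, hpred n (by omega) h1.2]
  · refine (hK.sdiff (Set.finite_Iio M)).mono fun n hn => ?_
    have h1 : zrun X n = K := hn.1
    have h2 : M ≤ n := by simpa using hn.2
    simp [hst, h2, h1]

/-- gap above every dyadic truncation gives bounded zero runs -/
theorem predict_real (α : ℝ) (m : ℕ)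
    (h : (∀ n : ℕ, (⌊α * 2 ^ n⌋ : ℝ) < α * 2 ^ n) →
      ∀ n : ℕ, (⌊α * 2 ^ n⌋ : ℝ) + ((2:ℝ) ^ m)⁻¹ ≤ α * 2 ^ n) :
    FiniteStateStronglyPredictable (fun n => binDigit α n) := by
  by_cases hg : ∀ n : ℕ, (⌊α * 2 ^ n⌋ : ℝ) < α * 2 ^ n
  · refine predict_run _ m fun n => ?_
    by_contra! hc
    have hz : ∀ k, k ≤ m → ⌊α * 2 ^ (n + k)⌋ = ⌊α * 2 ^ n⌋ * 2 ^ k := by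
      intro k
      induction k with
      | zero => simp
      | succ k ih =>
        intro hk
        have i1 := ih (by omega)
        have h1 := hc k (by omega)
        simp only [binDigit, ne_eq, decide_eq_true_eq] at h1
        rw [← add_assoc]
        have h2 : ⌊α * 2 ^ (n + k + 1)⌋ / 2 = ⌊α * 2 ^ (n + k)⌋ := by
          have := Int.floor_div_natCast (α * 2 ^ (n + k + 1)) 2
          push_cast at this
          rw [← this]; congr 1; rw [pow_succ]; ring
        have h3 : ⌊α * 2 ^ (n + k + 1)⌋ = ⌊α * 2 ^ (n + k)⌋ * 2 := by omega
        rw [h3, i1, pow_succ]; ring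
    have h1 := hz m le_rfl
    have h2 := h hg n
    have h3 := Int.lt_floor_add_one (α * 2 ^ (n + m))
    rw [h1] at h3
    push_cast at h3
    rw [pow_add] at h3
    have h4 : ((⌊α * 2 ^ n⌋ : ℝ) + ((2:ℝ) ^ m)⁻¹) * 2 ^ m ≤ α * 2 ^ n * 2 ^ m := by gcongr
    rw [add_mul, inv_mul_cancel₀ (by positivity)] at h4
    linarith
  · push Not at hg
    obtain ⟨N, hN⟩ := hg
    have he : α * 2 ^ N = ⌊α * 2 ^ N⌋ := le_antisymm hN (Int.floor_le _)
    refine predict_zero _ N fun n hn => ?_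
    obtain ⟨k, rfl⟩ := Nat.exists_eq_add_of_le hn
    have : α * 2 ^ (N + k + 1) = ((⌊α * 2 ^ N⌋ * 2 ^ k * 2 : ℤ) : ℝ) := by
      rw [pow_succ, pow_add, ← mul_assoc, ← mul_assoc, he]; push_cast; simp
    simp only [binDigit, this, Int.floor_intCast]
    simp

theorem kraft_pf (S : Finset (List Bool)) (h : ∀ p ∈ S, ∀ q ∈ S, p <+: q → p = q) :
    ∑ w ∈ S, ((2:ℝ) ^ w.length)⁻¹ ≤ 1 := by
  by_cases he : [] ∈ S
  · have : S = {[]} := by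
      ext q; simp only [Finset.mem_singleton]
      exact ⟨fun hq => (h [] he q hq List.nil_prefix).symm, fun hq => hq ▸ he⟩
    simp [this]
  · have hu : InformationTheory.UniquelyDecodable (S : Set (List Bool)) := by
      intro L₁ L₂ h1 h2 hf
      induction L₁ generalizing L₂ with
      | nil =>
        cases L₂ with
        | nil => rfl
        | cons b L₂ =>
          exfalso
          simp only [List.flatten_nil, List.flatten_cons] at hf
          have : b = [] := (List.append_eq_nil_iff.1 hf.symm).1
          exact he (this ▸ h2 b (by simp))
      | cons a L₁ ih =>
        cases L₂ with
        | nil =>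
          exfalso
          simp only [List.flatten_nil, List.flatten_cons] at hf
          have : a = [] := (List.append_eq_nil_iff.1 hf).1
          exact he (this ▸ h1 a (by simp))
        | cons b L₂ =>
          simp only [List.flatten_cons] at hf
          have hab : a = b := by
            have p1 : a <+: b ++ L₂.flatten := hf ▸ List.prefix_append _ _
            have p2 : b <+: b ++ L₂.flatten := List.prefix_append _ _
            rcases List.prefix_or_prefix_of_prefix p1 p2 with h' | h'
            · exact h a (h1 a (by simp)) b (h2 b (by simp)) h'
            · exact (h b (h2 b (by simp)) a (h1 a (by simp)) h').symm
          subst hab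
          rw [ih L₂ (fun w hw => h1 w (by simp [hw])) (fun w hw => h2 w (by simp [hw]))
            (List.append_cancel_left hf)]
    have := InformationTheory.kraft_mcmillan_inequality hu
    simpa using this

open Encodable

theorem length_le_enc (l : List Bool) : l.length ≤ encode l := by
  induction l with
  | nil => simp
  | cons a l ih =>
    rw [Encodable.encode_list_cons, List.length_cons]
    have := Nat.right_le_pair (encode a) (encode l)
    omega

theorem stages (U : List Bool →. List Bool) (hU : Partrec U) :
    ∃ (mem : ℕ → ℕ → Bool) (len : ℕ → ℕ) (out : ℕ → List Bool),
      Computable₂ mem ∧ Computable len ∧ Computable out ∧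
      (∀ t t' i, t ≤ t' → mem t i = true → mem t' i = true) ∧
      (∀ t i, mem t i = true → i < t ∧ ∃ p : List Bool, encode p = i ∧ (U p).Dom) ∧
      (∀ p : List Bool, (U p).Dom → ∃ t, mem t (encode p) = true) ∧
      (∀ p : List Bool, len (encode p) = p.length) ∧
      (∀ t (p : List Bool), mem t (encode p) = true → out t ∉ U p) := by
  obtain ⟨c, hc⟩ := Nat.Partrec.Code.exists_code.1 hU
  have hc1 : ∀ p : List Bool, Nat.Partrec.Code.eval c (encode p) = (U p).map encode := by
    intro p; rw [hc]; simp
  set dec : ℕ → List Bool := fun i => ((decode i : Option (List Bool)).getD []) with hdec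
  have hdece : ∀ p, dec (encode p) = p := fun p => by simp [hdec]
  have cdec : Computable dec :=
    Computable.option_getD Computable.decode (Computable.const [])
  have cev : Computable₂ fun t i : ℕ => Nat.Partrec.Code.evaln t c i :=
    (Nat.Partrec.Code.primrec_evaln.to_comp.comp
      (Computable.pair (Computable.pair Computable.fst (Computable.const c)) Computable.snd)).to₂
  set mem : ℕ → ℕ → Bool := fun t i =>
    decide (encode (dec i) = i) && (Nat.Partrec.Code.evaln t c i).isSome with hmem
  have hmemiff : ∀ t i, mem t i = true ↔ encode (dec i) = i ∧
      ∃ e, e ∈ Nat.Partrec.Code.evaln t c i := by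
    intro t i; simp [hmem, Option.isSome_iff_exists]
  set w : ℕ → ℕ := fun t => ∑ i ∈ Finset.range t,
    (Nat.Partrec.Code.evaln t c i).getD 0 + 1 with hw
  have cw : Computable w := comp_add (comp_sum
    (f := fun t i => (Nat.Partrec.Code.evaln t c i).getD 0)
      (Computable.option_getD cev (Computable.const 0)).to₂ Computable.id) (Computable.const 1)
  have crep : Computable fun n : ℕ => List.replicate n true := by
    have h : Computable fun n : ℕ => Nat.rec (motive := fun _ => List Bool) []
        (fun _ IH => true :: IH) n :=
      Computable.nat_rec (h := fun _ p => true :: p.2) Computable.id (Computable.const [])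
        ((Computable.list_cons.comp (Computable.const true)
          (Computable.snd.comp Computable.snd)).to₂)
    refine h.of_eq fun n => ?_
    induction n with
    | zero => rfl
    | succ n ih => rw [List.replicate_succ, ← ih]
  refine ⟨mem, fun i => (dec i).length, fun t => List.replicate (w t) true, ?_, ?_, ?_, ?_, ?_,
    ?_, ?_, ?_⟩
  · exact (comp_and (comp_eq ((Computable.encode.comp cdec).comp Computable.snd) Computable.snd)
      (Primrec.option_isSome.to_comp.comp cev)).to₂
  · exact Computable.list_length.comp cdec
  · exact crep.comp cw
  · intro t t' i h h1
    obtain ⟨h2, e, he⟩ := (hmemiff _ _).1 h1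
    exact (hmemiff _ _).2 ⟨h2, e, Nat.Partrec.Code.evaln_mono h he⟩
  · intro t i h1
    obtain ⟨h2, e, he⟩ := (hmemiff _ _).1 h1
    refine ⟨Nat.Partrec.Code.evaln_bound he, dec i, h2, ?_⟩
    have h3 := Nat.Partrec.Code.evaln_sound he
    rw [← h2, hc1] at h3
    obtain ⟨a, ha, -⟩ := (Part.mem_map_iff _).1 h3
    exact Part.dom_iff_mem.2 ⟨a, ha⟩
  · intro p hp
    obtain ⟨a, ha⟩ := Part.dom_iff_mem.1 hp
    have h3 : encode a ∈ Nat.Partrec.Code.eval c (encode p) := by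
      rw [hc1]; exact Part.mem_map _ ha
    obtain ⟨k, hk⟩ := Nat.Partrec.Code.evaln_complete.1 h3
    exact ⟨k, (hmemiff _ _).2 ⟨by rw [hdece], _, hk⟩⟩
  · intro p; simp only [hdece]
  · intro t p h1 hout
    obtain ⟨h2, e, he⟩ := (hmemiff _ _).1 h1
    have h3 := Nat.Partrec.Code.evaln_sound he
    rw [hc1] at h3
    obtain ⟨a, ha, hae⟩ := (Part.mem_map_iff _).1 h3
    have h4 := Part.mem_unique ha hout
    have h5 := length_le_enc a
    rw [hae, h4, List.length_replicate] at h5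
    have h6 : (Nat.Partrec.Code.evaln t c (encode p)).getD 0 ≤ ∑ i ∈ Finset.range t,
        (Nat.Partrec.Code.evaln t c i).getD 0 :=
      Finset.single_le_sum (f := fun i => (Nat.Partrec.Code.evaln t c i).getD 0)
        (fun _ _ => Nat.zero_le _)
        (Finset.mem_range.2 (Nat.Partrec.Code.evaln_bound he))
    have h7 : (Nat.Partrec.Code.evaln t c (encode p)).getD 0 = e := by
      rw [Option.mem_def.1 he]; rfl
    simp only [hw] at h5
    omega

theorem rpow_le_kraft (T : ℝ) (hT0 : 0 < T) (hT1 : T < 1) (l : ℕ) :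
    (2:ℝ) ^ (-(l:ℝ) / T) ≤ ((2:ℝ) ^ l)⁻¹ := by
  rw [← Real.rpow_natCast, ← Real.rpow_neg (by norm_num)]
  apply Real.rpow_le_rpow_of_exponent_le (by norm_num)
  rw [div_le_iff₀ hT0]
  have : (0:ℝ) ≤ l := Nat.cast_nonneg _
  nlinarith

theorem real_part (U : List Bool →. List Bool) (hU : IsPrefixFreeMachine U)
    (T : ℝ) (hT0 : 0 < T) (hT1 : T < 1) (D : ℕ → Finset ℕ) (hD : Monotone D) (len : ℕ → ℕ)
    (hDU : ∀ t, ∀ i ∈ D t, ∃ p : List Bool, encode p = i ∧ (U p).Dom)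
    (hUD : ∀ p : List Bool, (U p).Dom → ∃ t, encode p ∈ D t)
    (hlen : ∀ p : List Bool, len (encode p) = p.length) :
    (∀ t, ∑ i ∈ D t, ((2:ℝ) ^ len i)⁻¹ ≤ 1) ∧
    (∀ t, ∑ i ∈ D t, (2:ℝ) ^ (-(len i:ℝ) / T) ≤ ZT U T) ∧
    (∀ t (q : List Bool), (U q).Dom → encode q ∉ D t →
      ∑ i ∈ D t, (2:ℝ) ^ (-(len i:ℝ) / T) + (2:ℝ) ^ (-(q.length:ℝ) / T) ≤ ZT U T) ∧
    Filter.Tendsto (fun t => ∑ i ∈ D t, (2:ℝ) ^ (-(len i:ℝ) / T)) Filter.atTop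
      (nhds (ZT U T)) := by
  classical
  set E : Set ℕ := {i | ∃ p : List Bool, encode p = i ∧ (U p).Dom} with hE
  set a : ℕ → ℝ := fun i => (2:ℝ) ^ (-(len i:ℝ) / T) with ha
  set g : ℕ → ℝ := fun i => if i ∈ E then a i else 0 with hg
  have ha0 : ∀ i, 0 < a i := fun i => by simp only [ha]; positivity
  have hg0 : ∀ i, 0 ≤ g i := fun i => by
    simp only [hg]; split_ifs
    · exact (ha0 i).le
    · exact le_rfl
  have kraftE : ∀ F : Finset ℕ, (∀ i ∈ F, i ∈ E) → ∑ i ∈ F, ((2:ℝ) ^ len i)⁻¹ ≤ 1 := by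
    intro F hF
    set S : Finset (List Bool) := F.preimage encode (encode_injective.injOn) with hS
    have h1 : F = S.image encode := by
      ext i
      simp only [Finset.mem_image, hS, Finset.mem_preimage]
      constructor
      · intro hi
        obtain ⟨p, hp, -⟩ := hF i hi
        exact ⟨p, hp ▸ hi, hp⟩
      · rintro ⟨p, hp, rfl⟩; exact hp
    have hS2 : ∀ p ∈ S, (U p).Dom := by
      intro p hp
      obtain ⟨q, hq, hd⟩ := hF (encode p) (Finset.mem_preimage.1 hp)
      rw [← encode_injective hq]; exact hd
    rw [h1, Finset.sum_image (encode_injective.injOn)]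
    simp only [hlen]
    exact kraft_pf S fun p hp q hq => hU.2 p q (hS2 p hp) (hS2 q hq)
  have hDE : ∀ t, ∀ i ∈ D t, i ∈ E := hDU
  have hsg : Summable g := by
    refine summable_of_sum_le hg0 (c := 1) fun u => ?_
    simp only [hg]
    rw [← Finset.sum_filter]
    refine le_trans (Finset.sum_le_sum fun i _ => rpow_le_kraft T hT0 hT1 (len i)) ?_
    exact kraftE _ fun i hi => (Finset.mem_filter.1 hi).2
  have hZ : ZT U T = ∑' i, g i := by
    have hinj : Function.Injective (fun p : {p : List Bool // (U p).Dom} => encode p.1) :=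
      fun p q h => Subtype.ext (encode_injective h)
    rw [← hinj.tsum_eq (f := g)]
    · unfold ZT
      refine tsum_congr fun p => ?_
      have : encode p.1 ∈ E := ⟨p.1, rfl, p.2⟩
      simp only [hg, this, if_true, ha, hlen]
    · intro i hi
      have : i ∈ E := by
        by_contra hc
        exact hi (by simp [hg, hc])
      obtain ⟨p, hp, hd⟩ := this
      exact ⟨⟨p, hd⟩, hp⟩
  have hDg : ∀ t, ∑ i ∈ D t, a i = ∑ i ∈ D t, g i := fun t =>
    Finset.sum_congr rfl fun i hi => by simp [hg, hDE t i hi]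
  have hle : ∀ t, ∑ i ∈ D t, a i ≤ ZT U T := by
    intro t
    rw [hDg, hZ]
    exact hsg.sum_le_tsum _ fun i _ => hg0 i
  refine ⟨fun t => kraftE _ (hDE t), hle, ?_, ?_⟩
  · intro t q hq hqD
    have h1 : g (encode q) = (2:ℝ) ^ (-(q.length:ℝ) / T) := by
      have : encode q ∈ E := ⟨q, rfl, hq⟩
      simp only [hg, this, if_true, ha, hlen]
    change ∑ i ∈ D t, a i + _ ≤ _
    rw [hDg, hZ, ← h1, add_comm, ← Finset.sum_insert hqD]
    exact hsg.sum_le_tsum _ fun i _ => hg0 i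
  · refine tendsto_order.2 ⟨fun x hx => ?_, fun x hx => ?_⟩
    · have hs : HasSum g (ZT U T) := hZ ▸ hsg.hasSum
      obtain ⟨u, hu⟩ := ((tendsto_order.1 hs).1 x hx).exists
      have hev : ∀ᶠ t in Filter.atTop, ∀ i ∈ u.filter (· ∈ E), i ∈ D t := by
        rw [Filter.eventually_all_finset]
        intro i hi
        obtain ⟨p, hp, hd⟩ := (Finset.mem_filter.1 hi).2
        obtain ⟨t, ht⟩ := hUD p hd
        filter_upwards [Filter.eventually_ge_atTop t] with t' ht'
        exact hD ht' (hp ▸ ht)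
      filter_upwards [hev] with t ht
      refine lt_of_lt_of_le hu ?_
      have : ∑ i ∈ u, g i = ∑ i ∈ u.filter (· ∈ E), a i := by
        simp only [hg]; rw [Finset.sum_filter]
      rw [this]
      exact Finset.sum_le_sum_of_subset_of_nonneg ht fun i _ _ => (ha0 i).le
    · exact Filter.Eventually.of_forall fun t => (hle t).trans_lt hx

open Encodable

theorem exists_gap (U : List Bool →. List Bool) (hU : IsOptimalMachine U)
    (T : ℝ) (hT0 : 0 < T) (hT1 : T < 1) (hTc : ComputableReal T) :
    ∃ m : ℕ, (∀ n : ℕ, (⌊ZT U T * 2 ^ n⌋ : ℝ) < ZT U T * 2 ^ n) →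
      ∀ n : ℕ, (⌊ZT U T * 2 ^ n⌋ : ℝ) + ((2:ℝ) ^ m)⁻¹ ≤ ZT U T * 2 ^ n := by
  obtain ⟨g, hg, hgT⟩ := exists_nat_approx T hT0 hTc
  obtain ⟨v, cv, hv⟩ := exists_v T hT0 g hg hgT
  obtain ⟨L, cL, hL⟩ := exists_L T hT0 g hg hgT
  obtain ⟨c, hc⟩ := weight_bound T hT0 hT1
  obtain ⟨mem, len, out, cmem, clen, cout, hmono, hmemU, hUmem, hlen, hout⟩ := stages U hU.1.1
  set D : ℕ → Finset ℕ := fun t => (Finset.range t).filter (fun i => mem t i = true) with hDdef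
  have hDmem : ∀ t i, i ∈ D t ↔ mem t i = true := by
    intro t i
    simp only [hDdef, Finset.mem_filter, Finset.mem_range]
    exact ⟨fun h => h.2, fun h => ⟨(hmemU t i h).1, h⟩⟩
  have hD : Monotone D := fun t t' h i hi =>
    (hDmem _ _).2 (hmono t t' i h ((hDmem _ _).1 hi))
  obtain ⟨hkraft, hsle, hsq, hlim⟩ := real_part U hU.1 T hT0 hT1 D hD len
    (fun t i hi => (hmemU t i ((hDmem _ _).1 hi)).2)
    (fun p hp => (hUmem p hp).imp fun t ht => (hDmem _ _).2 ht) hlen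
  set α := ZT U T with hα
  set s : ℕ → ℝ := fun t => ∑ i ∈ D t, (2:ℝ) ^ (-(len i:ℝ) / T) with hs
  set V : ℕ → ℕ := fun t => ∑ i ∈ Finset.range t, (mem t i).toNat * v (2 * t + 1) (len i) with hV
  have hVD : ∀ t, (V t : ℝ) = ∑ i ∈ D t, (v (2 * t + 1) (len i) : ℝ) := by
    intro t
    simp only [hV, hDdef]
    push_cast
    rw [Finset.sum_filter]
    refine Finset.sum_congr rfl fun i _ => ?_
    cases mem t i <;> simp
  have hVu : ∀ t, (V t : ℝ) ≤ 2 ^ (2 * t + 1) * s t := by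
    intro t
    rw [hVD, hs, Finset.mul_sum]
    exact Finset.sum_le_sum fun i _ => (hv _ _).1
  have hcard : ∀ t, ((D t).card : ℝ) ≤ t := by
    intro t
    have : (D t).card ≤ t := by
      simpa using Finset.card_filter_le (Finset.range t) (fun i => mem t i = true)
    exact_mod_cast this
  have hVl : ∀ t, 2 ^ (2 * t + 1) * s t ≤ (V t : ℝ) + 2 * t := by
    intro t
    have h1 : 2 ^ (2 * t + 1) * s t ≤ ∑ i ∈ D t, ((v (2 * t + 1) (len i) : ℝ) + 2) := by
      rw [hs, Finset.mul_sum]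
      exact Finset.sum_le_sum fun i _ => (hv _ _).2
    rw [Finset.sum_add_distrib, ← hVD, Finset.sum_const, nsmul_eq_mul] at h1
    have := hcard t
    linarith
  set key : ℕ → ℕ → ℕ := fun t n => V t / 2 ^ (2 * t + 1 - n) with hkeydef
  have hkfl : ∀ t n, key t n = ⌊(V t : ℝ) / 2 ^ (2 * t + 1 - n)⌋₊ := by
    intro t n
    simp only [hkeydef]
    rw [← Nat.floor_div_eq_div (K := ℝ)]
    push_cast; rfl
  have hpow : ∀ t n : ℕ, n ≤ t → (2:ℝ) ^ (2 * t + 1) = 2 ^ n * 2 ^ (2 * t + 1 - n) := by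
    intro t n h
    rw [← pow_add]; congr 1; omega
  have hqu : ∀ t n, n ≤ t → (V t : ℝ) / 2 ^ (2 * t + 1 - n) ≤ 2 ^ n * s t := by
    intro t n h
    rw [div_le_iff₀ (by positivity)]
    have := hVu t
    rw [hpow t n h] at this
    linarith
  have hql : ∀ t n, n ≤ t →
      2 ^ n * s t - 2 ^ n * (1/2 : ℝ) ^ t ≤ (V t : ℝ) / 2 ^ (2 * t + 1 - n) := by
    intro t n h
    rw [le_div_iff₀ (by positivity)]
    have h1 := hVl t
    have h2 : (t : ℝ) ≤ 2 ^ t := by exact_mod_cast Nat.lt_two_pow_self.le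
    have h3 : (1/2 : ℝ) ^ t * 2 ^ (2 * t + 1) = 2 * 2 ^ t := by
      rw [one_div, inv_pow, pow_succ, two_mul, pow_add]; field_simp
    have h4 : (2 ^ n * s t - 2 ^ n * (1/2 : ℝ) ^ t) * 2 ^ (2 * t + 1 - n) =
        2 ^ (2 * t + 1) * s t - (1/2 : ℝ) ^ t * 2 ^ (2 * t + 1) := by
      rw [hpow t n h]; ring
    rw [h4, h3]; linarith
  have hs0 : ∀ t, 0 ≤ s t := fun t => Finset.sum_nonneg fun _ _ => by positivity
  have hkle : ∀ t n, n ≤ t → (key t n : ℝ) ≤ 2 ^ n * s t := by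
    intro t n h
    rw [hkfl]
    exact (Nat.floor_le (by positivity)).trans (hqu t n h)
  have hkey : ∀ t n, n ≤ t →
      (key t n : ℤ) = ⌊∑ i ∈ D t, 2 ^ n * (2:ℝ) ^ (-(len i:ℝ) / T)⌋ ∨
      (key t n : ℤ) + 1 = ⌊∑ i ∈ D t, 2 ^ n * (2:ℝ) ^ (-(len i:ℝ) / T)⌋ := by
    intro t n h
    rw [← Finset.mul_sum]
    change (key t n : ℤ) = ⌊2 ^ n * s t⌋ ∨ (key t n : ℤ) + 1 = ⌊2 ^ n * s t⌋
    have h1 : (key t n : ℤ) ≤ ⌊2 ^ n * s t⌋ := by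
      rw [Int.le_floor]; exact_mod_cast hkle t n h
    have h2 : (V t : ℝ) / 2 ^ (2 * t + 1 - n) < key t n + 1 := by
      rw [hkfl]; exact Nat.lt_floor_add_one _
    have h3 := hql t n h
    have h4 : (2:ℝ) ^ n * (1/2 : ℝ) ^ t ≤ 1 := by
      rw [one_div, inv_pow, ← div_eq_mul_inv, div_le_one (by positivity)]
      exact pow_le_pow_right₀ (by norm_num) h
    have h5 : ⌊2 ^ n * s t⌋ < (key t n : ℤ) + 2 := by
      rw [Int.floor_lt]; push_cast; linarith
    omega
  set valid : ℕ → ℕ → Bool := fun n t => decide (n ≤ t) && decide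
    (∑ t' ∈ Finset.range t, (decide (n ≤ t') && decide (key t' n = key t n)).toNat = 0) with hvalid
  have hvalidiff : ∀ n t, valid n t = true ↔
      n ≤ t ∧ ∀ t' < t, n ≤ t' → key t' n ≠ key t n := by
    intro n t
    simp only [hvalid, Bool.and_eq_true, decide_eq_true_eq, Finset.sum_eq_zero_iff,
      Finset.mem_range, Bool.toNat_eq_zero, Bool.and_eq_false_imp, decide_eq_false_iff_not]
  have hw := hc D hD len hkraft key hkey L (fun n => (hL n).1) valid
    (fun n t h => (hvalidiff n t).1 h)
  have cV : Computable V := comp_sum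
    (f := fun t i => (mem t i).toNat * v (2 * t + 1) (len i))
    (comp_mul (comp_toNat (cmem.comp Computable.fst Computable.snd)) (cv.comp
      (comp_add (comp_mul (Computable.const 2) Computable.fst) (Computable.const 1))
      (clen.comp Computable.snd))).to₂ Computable.id
  have ckey : Computable₂ key := (comp_div (cV.comp Computable.fst)
    (comp_pow (Computable.const 2) (comp_sub (comp_add (comp_mul (Computable.const 2)
      Computable.fst) (Computable.const 1)) Computable.snd))).to₂
  have cvalid : Computable₂ valid := by
    have h1 : Computable fun z : ℕ × ℕ => ∑ t' ∈ Finset.range z.2,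
        (decide (z.1 ≤ t') && decide (key t' z.1 = key z.2 z.1)).toNat :=
      comp_sum (f := fun (z : ℕ × ℕ) t' =>
        (decide (z.1 ≤ t') && decide (key t' z.1 = key z.2 z.1)).toNat)
        (comp_toNat (comp_and (comp_le (Computable.fst.comp Computable.fst) Computable.snd)
          (comp_eq (ckey.comp Computable.snd (Computable.fst.comp Computable.fst))
            (ckey.comp (Computable.snd.comp Computable.fst)
              (Computable.fst.comp Computable.fst))))).to₂ Computable.snd
    exact (comp_and (comp_le Computable.fst Computable.snd)
      (comp_eq h1 (Computable.const 0))).to₂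
  have c1 : Computable fun y : ℕ => y.unpair.1 := Computable.fst.comp Primrec.unpair.to_comp
  have c2 : Computable fun y : ℕ => y.unpair.2 := Computable.snd.comp Primrec.unpair.to_comp
  obtain ⟨M, hM, hMreq⟩ := kraft_chaitin (fun j => valid j.unpair.1 j.unpair.2)
    (fun j => c + L j.unpair.1) (fun j => out j.unpair.2)
    (cvalid.comp c1 c2) (comp_add (Computable.const c) (cL.comp c1)) (cout.comp c2) (by
      intro J
      refine le_trans ?_ (hw J)
      rw [← Finset.sum_product']
      have hinj : Set.InjOn Nat.unpair (Finset.range J : Set ℕ) := fun a _ b _ h => by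
        rw [← Nat.pair_unpair a, h, Nat.pair_unpair]
      rw [← Finset.sum_image (s := Finset.range J) (g := Nat.unpair)
        (f := fun z : ℕ × ℕ => ((valid z.1 z.2).toNat : ℝ) * ((2:ℝ) ^ (c + L z.1))⁻¹) hinj]
      refine Finset.sum_le_sum_of_subset_of_nonneg ?_ fun _ _ _ => by positivity
      intro z hz
      obtain ⟨j, hj, rfl⟩ := Finset.mem_image.1 hz
      have hj := Finset.mem_range.1 hj
      have a1 := Nat.unpair_left_le j
      have a2 := Nat.unpair_right_le j
      simp only [Finset.mem_product, Finset.mem_range]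
      omega)
  obtain ⟨d, hd⟩ := hU.2 M hM
  obtain ⟨m, hm⟩ := exists_nat_ge (((c:ℝ) + 6 + d) / T)
  refine ⟨m, fun hgt n => ?_⟩
  have hα0 : 0 ≤ α := (hs0 0).trans (hsle 0)
  have hex : ∃ t, n ≤ t ∧ (key t n : ℤ) = ⌊α * 2 ^ n⌋ := by
    have ht : Filter.Tendsto (fun t => 2 ^ n * s t - 2 ^ n * (1/2 : ℝ) ^ t) Filter.atTop
        (nhds (2 ^ n * α - 2 ^ n * 0)) :=
      (hlim.const_mul _).sub ((tendsto_pow_atTop_nhds_zero_of_lt_one (by norm_num)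
        (by norm_num)).const_mul _)
    have hlt : (⌊α * 2 ^ n⌋ : ℝ) < 2 ^ n * α - 2 ^ n * 0 := by
      have := hgt n; linarith
    obtain ⟨t, h1, h2⟩ := (((tendsto_order.1 ht).1 _ hlt).and
      (Filter.eventually_ge_atTop n)).exists
    refine ⟨t, h2, le_antisymm ?_ ?_⟩
    · rw [Int.le_floor]
      have h3 := hkle t n h2
      have h4 : 2 ^ n * s t ≤ 2 ^ n * α := by gcongr; exact hsle t
      push_cast; linarith
    · have h3 := hql t n h2
      have h5 : (0:ℝ) ≤ (V t : ℝ) / 2 ^ (2 * t + 1 - n) := by positivity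
      rw [hkfl, Int.natCast_floor_eq_floor h5, Int.le_floor]
      linarith
  classical
  set t := Nat.find hex with htdef
  obtain ⟨hnt, hkt⟩ := Nat.find_spec hex
  have hvt : valid n t = true := by
    refine (hvalidiff n t).2 ⟨hnt, fun t' ht' hnt' heq => ?_⟩
    exact Nat.find_min hex ht' ⟨hnt', by rw [heq]; exact hkt⟩
  obtain ⟨p, hpl, hMp⟩ := hMreq (Nat.pair n t) (by simpa using hvt)
  simp only [Nat.unpair_pair] at hpl hMp
  obtain ⟨q, hql', hUq⟩ := hd p (by rw [hMp]; trivial)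
  have hmemq : out t ∈ U q := by rw [hUq, hMp]; exact Part.mem_some _
  have hqD : encode q ∉ D t := fun h => hout t q ((hDmem _ _).1 h) hmemq
  have h1 := hsq t q (Part.dom_iff_mem.2 ⟨_, hmemq⟩) hqD
  have h2 : (⌊α * 2 ^ n⌋ : ℝ) ≤ 2 ^ n * s t := by
    have h3 := hkle t n hnt
    have h4 : ((key t n : ℤ) : ℝ) = ⌊α * 2 ^ n⌋ := by rw [hkt]
    push_cast at h4
    linarith
  have h5 : ((2:ℝ) ^ m)⁻¹ ≤ 2 ^ n * (2:ℝ) ^ (-(q.length:ℝ) / T) := by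
    rw [← Real.rpow_natCast 2 m, ← Real.rpow_natCast 2 n, ← Real.rpow_neg (by norm_num),
      ← Real.rpow_add (by norm_num)]
    apply Real.rpow_le_rpow_of_exponent_le (by norm_num)
    have h6 : (q.length : ℝ) ≤ (c + L n + 1) + d := by
      have : q.length ≤ c + L n + 1 + d := by omega
      exact_mod_cast this
    have h7 := (hL n).2
    rw [div_le_iff₀ hT0] at hm
    have h8 : (q.length : ℝ) / T ≤ n + m := by
      rw [div_le_iff₀ hT0]; linarith
    rw [neg_div]; linarith
  have h9 : 2 ^ n * (s t + (2:ℝ) ^ (-(q.length:ℝ) / T)) ≤ 2 ^ n * α := by gcongr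
  linarith

end Helpers

theorem ZT_finiteStateStronglyPredictable
    (U : List Bool →. List Bool) (hU : IsOptimalMachine U)
    (T : ℝ) (hT0 : 0 < T) (hT1 : T < 1) (hTc : ComputableReal T) :
    FiniteStateStronglyPredictable (fun n => binDigit (ZT U T) n) := by
  obtain ⟨m, hm⟩ := exists_gap U hU T hT0 hT1 hTc
  exact predict_real _ m hm
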